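/- arXiv:2511.03135 — 3 statements merged into one kernel-verified Lean document; each statement's English description precedes it below -/
import Mathlib

section
/- Let M and N be two matroids on the same ground set V, and let A_1, …, A_{2n-1} be subsets of V each independent in both M and N, with |A_i| ≥ min(i, n) for all i. Then there exist indices 1 ≤ i_1 < ⋯ < i_n ≤ 2n-1 and distinct elements x_1 ∈ A_{i_1}, …, x_n ∈ A_{i_n} such that {x_1, …, x_n} is independent in both M and N. -/
/-- Mod 2 boundary of a chain. -/
def rbBd {W : Type*} [Fintype W] [DecidableEq W] (z : Finset W → ZMod 2) (τ : Finset W) : ZMod 2 :=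
  ∑ v ∈ τᶜ, z (insert v τ)

/-- Low-dimensional cycles supported in `Z` are boundaries of chains supported in `X`. -/
def RbFillIn {W : Type*} [Fintype W] [DecidableEq W] (Z X : Finset W → Prop) (k : ℕ) : Prop :=
  ∀ s < k, ∀ z : Finset W → ZMod 2, (∀ σ, z σ ≠ 0 → Z σ ∧ σ.card = s) → rbBd z = 0 →
    ∃ w : Finset W → ZMod 2, (∀ σ, w σ ≠ 0 → X σ ∧ σ.card = s + 1) ∧ rbBd w = z

section chains
variable {W : Type*} [Fintype W] [DecidableEq W]

lemma rbBd_add (z w : Finset W → ZMod 2) : rbBd (z + w) = rbBd z + rbBd w := by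
  funext τ; simp [rbBd, Finset.sum_add_distrib]

lemma rbBd_sum {ι : Type*} (s : Finset ι) (f : ι → Finset W → ZMod 2) :
    rbBd (∑ i ∈ s, f i) = ∑ i ∈ s, rbBd (f i) := by
  funext τ
  simp only [rbBd, Finset.sum_apply]
  rw [Finset.sum_comm]

lemma rb_add_self (z : Finset W → ZMod 2) : z + z = 0 := by
  funext τ; exact CharTwo.add_self_eq_zero _

/-- A sum over ordered pairs of distinct elements of a symmetric function vanishes mod 2. -/
lemma rb_sum_pairs {V : Type*} [DecidableEq V] (s : Finset V) (f : V → V → ZMod 2)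
    (hf : ∀ u v, f u v = f v u) : ∑ v ∈ s, ∑ u ∈ s.erase v, f v u = 0 := by
  induction s using Finset.induction_on with
  | empty => simp
  | insert a s ha ih =>
    rw [Finset.sum_insert ha, Finset.erase_insert ha]
    have : ∑ v ∈ s, ∑ u ∈ (insert a s).erase v, f v u
        = ∑ v ∈ s, (f v a + ∑ u ∈ s.erase v, f v u) := by
      refine Finset.sum_congr rfl fun v hv => ?_
      have hva : a ≠ v := fun h => ha (h ▸ hv)
      rw [Finset.erase_insert_of_ne hva, Finset.sum_insert]
      simp [ha]
    rw [this, Finset.sum_add_distrib, ih, add_zero, ← Finset.sum_add_distrib]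
    refine Finset.sum_eq_zero fun v _ => ?_
    rw [hf v a]; exact CharTwo.add_self_eq_zero _

lemma rbBd_bd (z : Finset W → ZMod 2) : rbBd (rbBd z) = 0 := by
  funext τ
  have := rb_sum_pairs τᶜ (fun v u => z (insert u (insert v τ)))
    (fun u v => by rw [Finset.insert_comm])
  simp only [rbBd, Pi.zero_apply]
  rw [← this]
  refine Finset.sum_congr rfl fun v _ => ?_
  rw [Finset.compl_insert]

lemma RbFillIn.mono {Z X : Finset W → Prop} {k l : ℕ} (h : RbFillIn Z X k) (hl : l ≤ k) :
    RbFillIn Z X l := fun s hs => h s (hs.trans_le hl)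

lemma rbClear (Z Z' X L : Finset W → Prop) (C : Finset W) (k : ℕ)
    (h1 : ∀ σ, Z σ → C ⊆ σ → L (σ \ C))
    (h2 : ∀ σ, Z σ → ¬ C ⊆ σ → Z' σ)
    (h3 : ∀ ρ, L ρ → Disjoint ρ C ∧ X (ρ ∪ C))
    (h4 : ∀ ρ, L ρ → ∀ v ∈ C, Z' (ρ ∪ C.erase v))
    (hfill : RbFillIn L L (k - C.card)) (hZ' : RbFillIn Z' X k) : RbFillIn Z X k := by
  intro s hs z hz hbz
  by_cases hCs : C.card ≤ s
  swap
  · refine hZ' s hs z (fun σ hσ => ⟨h2 σ (hz σ hσ).1 fun hC => hCs ?_, (hz σ hσ).2⟩) hbz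
    rw [← (hz σ hσ).2]; exact Finset.card_le_card hC
  obtain ⟨δ, hδ, hbδ⟩ := hfill (s - C.card) (by omega)
    (fun σ => if Disjoint σ C then z (σ ∪ C) else 0)
    (by
      intro σ hσ
      split_ifs at hσ with hd
      · obtain ⟨hZ, hc⟩ := hz _ hσ
        have := h1 _ hZ Finset.subset_union_right
        rw [Finset.union_sdiff_cancel_right hd] at this
        rw [Finset.card_union_of_disjoint hd] at hc
        exact ⟨this, by omega⟩
      · exact absurd rfl hσ)
    (by
      funext ρ
      simp only [rbBd, Pi.zero_apply]
      by_cases hd : Disjoint ρ C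
      · have := congrFun hbz (ρ ∪ C)
        simp only [rbBd, Pi.zero_apply] at this
        refine Eq.trans (Eq.symm ?_) this
        apply Finset.sum_subset_zero_on_sdiff
        · intro v; simp; tauto
        · intro v hv
          simp only [Finset.mem_sdiff, Finset.mem_compl, Finset.mem_union] at hv
          rw [if_neg]
          rw [Finset.disjoint_insert_left]; tauto
        · intro v hv
          simp only [Finset.mem_compl, Finset.mem_union, not_or] at hv
          rw [if_pos, Finset.insert_union]
          rw [Finset.disjoint_insert_left]; tauto
      · refine Finset.sum_eq_zero fun v _ => if_neg fun h => hd ?_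
        exact (Finset.disjoint_insert_left.1 h).2)
  set g : Finset W → ZMod 2 := fun σ => if C ⊆ σ then δ (σ \ C) else 0 with hg
  obtain ⟨w, hw, hbw⟩ := hZ' s hs (z + rbBd g)
    (by
      intro τ hτ
      by_cases hC : C ⊆ τ
      · exfalso; apply hτ
        have e1 : rbBd g τ = rbBd δ (τ \ C) := by
          simp only [rbBd, hg]
          apply Finset.sum_subset_zero_on_sdiff
          · intro v; simp; tauto
          · intro v hv
            simp only [Finset.mem_sdiff, Finset.mem_compl, not_and, not_not] at hv
            by_contra hne
            have := (h3 _ (hδ _ hne).1).1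
            rw [Finset.disjoint_insert_left] at this
            tauto
          · intro v hv
            simp only [Finset.mem_compl] at hv
            rw [if_pos (hC.trans (Finset.subset_insert _ _)),
              Finset.insert_sdiff_of_notMem _ (fun h => hv (hC h))]
        rw [Pi.add_apply, e1, hbδ]
        simp only []
        rw [if_pos Finset.sdiff_disjoint, Finset.sdiff_union_of_subset hC]
        exact CharTwo.add_self_eq_zero _
      · by_cases hzτ : z τ = 0
        · rw [Pi.add_apply, hzτ, zero_add] at hτ
          obtain ⟨v, hv, hne⟩ := Finset.exists_ne_zero_of_sum_ne_zero hτ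
          simp only [hg] at hne
          split_ifs at hne with hCv
          · obtain ⟨hL, hc⟩ := hδ _ hne
            rw [Finset.mem_compl] at hv
            have hvC : v ∈ C := by
              by_contra hvC
              exact hC fun u hu => (Finset.mem_insert.1 (hCv hu)).resolve_left
                (fun h => hvC (h ▸ hu))
            have := h4 _ hL v hvC
            have e : insert v τ \ C ∪ C.erase v = τ := by
              ext u
              have := @hCv u
              simp only [Finset.mem_union, Finset.mem_sdiff, Finset.mem_insert, Finset.mem_erase] at this ⊢
              constructor
              · rintro (⟨rfl | h, h'⟩ | ⟨h, h'⟩)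
                · exact absurd hvC h'
                · exact h
                · exact (this h').resolve_left h
              · intro h
                have : u ≠ v := fun h' => hv (h' ▸ h)
                tauto
            rw [e] at this
            refine ⟨this, ?_⟩
            rw [Finset.card_sdiff_of_subset hCv, Finset.card_insert_of_notMem hv] at hc
            have := Finset.card_le_card hCv
            rw [Finset.card_insert_of_notMem hv] at this
            omega
          · exact absurd rfl hne
        · exact ⟨h2 _ (hz _ hzτ).1 hC, (hz _ hzτ).2⟩)
    (by rw [rbBd_add, hbz, rbBd_bd, add_zero])
  refine ⟨w + g, ?_, ?_⟩
  · intro σ hσ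
    by_cases hwσ : w σ = 0
    · rw [Pi.add_apply, hwσ, zero_add] at hσ
      simp only [hg] at hσ
      split_ifs at hσ with hC
      · obtain ⟨hL, hc⟩ := hδ _ hσ
        have := (h3 _ hL).2
        rw [Finset.sdiff_union_of_subset hC] at this
        refine ⟨this, ?_⟩
        rw [Finset.card_sdiff_of_subset hC] at hc
        have := Finset.card_le_card hC
        omega
      · exact absurd rfl hσ
    · exact hw _ hwσ
  · rw [rbBd_add, hbw, add_assoc, rb_add_self, add_zero]

lemma rbCone (Z X : Finset W → Prop) (x : W) (k : ℕ)
    (h : ∀ σ, Z σ → x ∉ σ ∧ X (insert x σ)) : RbFillIn Z X k := by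
  intro s _ z hz hbz
  refine ⟨fun σ => if x ∈ σ then z (σ.erase x) else 0, ?_, ?_⟩
  · intro σ hσ
    beta_reduce at hσ
    split_ifs at hσ with hx
    · obtain ⟨hZ, hc⟩ := hz _ hσ
      have := (h _ hZ).2
      rw [Finset.insert_erase hx] at this
      refine ⟨this, ?_⟩
      rw [← hc, Finset.card_erase_add_one hx]
    · exact absurd rfl hσ
  · funext τ
    simp only [rbBd]
    by_cases hx : x ∈ τ
    · have h0 : z τ = 0 := by
        by_contra hne
        exact (h _ (hz _ hne).1).1 hx
      rw [h0]
      have := congrFun hbz (τ.erase x)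
      simp only [rbBd, Pi.zero_apply] at this
      refine Eq.trans ?_ this
      apply Finset.sum_subset_zero_on_sdiff
      · intro v; simp; tauto
      · intro v hv
        simp only [Finset.mem_sdiff, Finset.mem_compl, Finset.mem_erase, not_not, not_and] at hv
        by_contra hne
        have hvx : v = x := by by_contra h'; exact hv.1 h' hv.2
        exact (h _ (hz _ hne).1).1 (by rw [hvx]; exact Finset.mem_insert_self _ _)
      · intro v hv
        have hvx : v ≠ x := fun h' => (Finset.mem_compl.1 hv) (h' ▸ hx)
        rw [if_pos (Finset.mem_insert_of_mem hx), Finset.erase_insert_of_ne hvx]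
    · rw [Finset.sum_eq_single x]
      · rw [if_pos (Finset.mem_insert_self _ _), Finset.erase_insert hx]
      · intro v _ hvx
        rw [if_neg]
        rw [Finset.mem_insert]; rintro (h' | h')
        · exact hvx h'.symm
        · exact hx h'
      · intro h'; exact absurd (Finset.mem_compl.2 hx) h'

lemma rbKey (X : Finset W → Prop) (U : Finset W) (x : W) (hx : x ∈ U) (k : ℕ)
    (hdown : ∀ σ τ, X σ → τ ⊆ σ → X τ)
    (hU : ∀ σ, X σ → ∀ y ∈ U, ∀ y' ∈ U, y ∈ σ → y' ∈ σ → y = y')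
    (hy : ∀ y ∈ U, RbFillIn (fun ρ => y ∉ ρ ∧ X (insert y ρ)) (fun ρ => y ∉ ρ ∧ X (insert y ρ))
      (k - 1))
    (hC : ∀ C, Disjoint C U → X C → ¬ X (insert x C) → (∀ D ⊂ C, X (insert x D)) →
      RbFillIn (fun ρ => Disjoint ρ C ∧ Disjoint ρ U ∧ X (ρ ∪ C))
        (fun ρ => Disjoint ρ C ∧ Disjoint ρ U ∧ X (ρ ∪ C)) (k - C.card))
    (hInt : ∀ σ C D, X σ → Disjoint σ U → C ⊆ σ → D ⊆ σ → ¬ X (insert x C) → ¬ X (insert x D) →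
      ¬ X (insert x (C ∩ D))) : RbFillIn X X k := by
  classical
  set 𝒞 : Finset (Finset W) := Finset.univ.filter fun C => X C ∧ Disjoint C U ∧
    ¬ X (insert x C) ∧ ∀ D ⊂ C, X (insert x D) with h𝒞
  have stepB : ∀ PP : Finset (Finset W), PP ⊆ 𝒞 →
      RbFillIn (fun σ => X σ ∧ Disjoint σ U ∧ ∀ C ∈ 𝒞 \ PP, ¬ C ⊆ σ) X k := by
    intro PP
    induction PP using Finset.induction_on with
    | empty =>
      intro _
      apply rbCone _ _ x
      rintro σ ⟨h1, h2, h3⟩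
      refine ⟨fun h => Finset.disjoint_left.1 h2 h hx, ?_⟩
      by_contra hn
      obtain ⟨C, hCσ, hmin⟩ := exists_minimal_le_of_wellFoundedLT
        (fun C => ¬ X (insert x C)) σ hn
      refine h3 C ?_ hCσ
      simp only [Finset.sdiff_empty, h𝒞, Finset.mem_filter, Finset.mem_univ, true_and]
      refine ⟨hdown _ _ h1 hCσ, Finset.disjoint_of_subset_left hCσ h2, hmin.prop, ?_⟩
      intro D hD
      by_contra hXD
      exact hD.2 (hmin.2 hXD hD.1)
    | insert C PP hCP ih =>
      intro hsub
      have hCC := hsub (Finset.mem_insert_self _ _)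
      have hCC' := hCC
      simp only [h𝒞, Finset.mem_filter, Finset.mem_univ, true_and] at hCC'
      obtain ⟨c1, c2, c3, c4⟩ := hCC'
      refine rbClear _ _ X (fun ρ => Disjoint ρ C ∧ Disjoint ρ U ∧ X (ρ ∪ C)) C k ?_ ?_ ?_ ?_
        (hC C c2 c1 c3 c4) (ih ((Finset.subset_insert _ _).trans hsub))
      · rintro σ ⟨s1, s2, s3⟩ hCσ
        refine ⟨Finset.sdiff_disjoint, Finset.disjoint_of_subset_left Finset.sdiff_subset s2, ?_⟩
        rwa [Finset.sdiff_union_of_subset hCσ]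
      · rintro σ ⟨s1, s2, s3⟩ hCσ
        refine ⟨s1, s2, ?_⟩
        intro D hD
        by_cases hDC : D = C
        · rwa [hDC]
        · apply s3; simp only [Finset.mem_sdiff, Finset.mem_insert] at hD ⊢; tauto
      · rintro ρ ⟨r1, r2, r3⟩; exact ⟨r1, r3⟩
      · rintro ρ ⟨r1, r2, r3⟩ v hv
        have hsub' : ρ ∪ C.erase v ⊆ ρ ∪ C :=
          Finset.union_subset_union_right (Finset.erase_subset _ _)
        refine ⟨hdown _ _ r3 hsub', ?_, ?_⟩
        · exact Finset.disjoint_of_subset_left hsub' (Finset.disjoint_union_left.2 ⟨r2, c2⟩)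
        · intro D hD hDsub
          have hD1 := (Finset.mem_sdiff.1 hD).1
          simp only [h𝒞, Finset.mem_filter, Finset.mem_univ, true_and] at hD1
          obtain ⟨d1, d2, d3, d4⟩ := hD1
          have hi := hInt _ C D r3 (Finset.disjoint_union_left.2 ⟨r2, c2⟩)
            Finset.subset_union_right (hDsub.trans hsub') c3 d3
          have hvD : v ∉ D := by
            intro h
            have := hDsub h
            rw [Finset.mem_union] at this
            rcases this with h' | h'
            · exact Finset.disjoint_left.1 r1 h' hv
            · exact Finset.notMem_erase _ _ h'
          refine hi (c4 _ ⟨Finset.inter_subset_left, fun h => hvD ?_⟩)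
          exact (Finset.mem_inter.1 (h hv)).2
  have stepB' : RbFillIn (fun σ => X σ ∧ Disjoint σ U) X k := by
    have := stepB 𝒞 (Finset.Subset.refl _)
    simpa using this
  have stepA : ∀ P : Finset W, P ⊆ U → RbFillIn (fun σ => X σ ∧ Disjoint σ (U \ P)) X k := by
    intro P
    induction P using Finset.induction_on with
    | empty => intro _; simpa using stepB'
    | insert y P hyP ih =>
      intro hsub
      have hyU := hsub (Finset.mem_insert_self _ _)
      refine rbClear _ _ X (fun ρ => y ∉ ρ ∧ X (insert y ρ)) {y} k ?_ ?_ ?_ ?_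
        (by simpa using hy y hyU) (ih ((Finset.subset_insert _ _).trans hsub))
      · rintro σ ⟨s1, s2⟩ hyσ
        rw [Finset.singleton_subset_iff] at hyσ
        rw [Finset.sdiff_singleton_eq_erase, Finset.insert_erase hyσ]
        exact ⟨Finset.notMem_erase _ _, s1⟩
      · rintro σ ⟨s1, s2⟩ hyσ
        rw [Finset.singleton_subset_iff] at hyσ
        refine ⟨s1, ?_⟩
        rw [Finset.disjoint_left] at s2 ⊢
        intro a ha
        have := s2 ha
        have hay : a ≠ y := fun h => hyσ (h ▸ ha)
        simp only [Finset.mem_sdiff, Finset.mem_insert] at this ⊢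
        tauto
      · rintro ρ ⟨r1, r2⟩
        refine ⟨Finset.disjoint_singleton_right.2 r1, ?_⟩
        rwa [Finset.union_comm, ← Finset.insert_eq]
      · rintro ρ ⟨r1, r2⟩ v hv
        rw [Finset.mem_singleton] at hv
        subst hv
        simp only [Finset.erase_singleton, Finset.union_empty]
        refine ⟨hdown _ _ r2 (Finset.subset_insert _ _), ?_⟩
        rw [Finset.disjoint_left]
        intro a ha haU
        have := hU _ r2 a (Finset.mem_sdiff.1 haU).1 v hyU (Finset.mem_insert_of_mem ha)
          (Finset.mem_insert_self _ _)
        exact r1 (this ▸ ha)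
  simpa using stepA U (Finset.Subset.refl _)

end chains
section matroids
open Matroid
variable {W : Type*} [Fintype W] [DecidableEq W]

lemma rbIndepInter {W : Type*} (N : Matroid W) (C D : Set W) (x : W) (hCD : N.Indep (C ∪ D))
    (hx : x ∉ C ∪ D) (hC : ¬ N.Indep (insert x C)) (hD : ¬ N.Indep (insert x D)) :
    ¬ N.Indep (insert x (C ∩ D)) := by
  have hC' := hCD.subset Set.subset_union_left
  have hD' := hCD.subset Set.subset_union_right
  have hxC : x ∉ C := fun h => hx (Or.inl h)
  have hxD : x ∉ D := fun h => hx (Or.inr h)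
  rw [hC'.insert_indep_iff_of_notMem hxC] at hC
  rw [hD'.insert_indep_iff_of_notMem hxD] at hD
  rw [(hC'.subset Set.inter_subset_left).insert_indep_iff_of_notMem (fun h => hxC h.1),
    hCD.closure_inter_eq_inter_closure]
  rintro ⟨hE, hn⟩
  simp only [Set.mem_sdiff, not_and, not_not] at hC hD
  exact hn ⟨hC hE, hD hE⟩

lemma rbAug {W : Type*} [DecidableEq W] (N : Matroid W) (C B : Finset W)
    (hC : N.Indep (C : Set W)) (hB : N.Indep (B : Set W)) :
    ∃ B' ⊆ B, Disjoint B' C ∧ N.Indep ((B' ∪ C : Finset W) : Set W) ∧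
      B.card ≤ B'.card + C.card := by
  classical
  obtain ⟨B', hB', hmax⟩ := Finset.exists_max_image
    (B.powerset.filter fun B' => Disjoint B' C ∧ N.Indep ((B' ∪ C : Finset W) : Set W))
    Finset.card ⟨∅, by simpa using hC⟩
  simp only [Finset.mem_filter, Finset.mem_powerset] at hB' hmax
  refine ⟨B', hB'.1, hB'.2.1, hB'.2.2, ?_⟩
  by_contra hlt
  have hcard := Finset.card_union_of_disjoint hB'.2.1
  obtain ⟨e, he, heI, hI⟩ := hB'.2.2.augment_finset hB (by omega)
  simp only [Finset.mem_union, not_or] at heI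
  have := hmax (insert e B') ⟨Finset.insert_subset he hB'.1, ?_, ?_⟩
  · rw [Finset.card_insert_of_notMem heI.1] at this; omega
  · rw [Finset.disjoint_insert_left]; exact ⟨heI.2, hB'.2.1⟩
  · rw [Finset.insert_union]; simpa using hI

/-- Rainbow independent sets. -/
def rbX {W κ : Type*} (c : W → κ) (N : Matroid W) (S : Finset W) (σ : Finset W) : Prop :=
  σ ⊆ S ∧ N.Indep (σ : Set W) ∧ Set.InjOn c (σ : Set W)

open Classical in
/-- Rank of a colour class. -/
noncomputable def rbRk {W κ : Type*} (c : W → κ) (N : Matroid W) (S : Finset W) (k : κ) : ℕ :=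
  (S.powerset.filter fun B : Finset W => (∀ b ∈ B, c b = k) ∧ N.Indep (B : Set W)).sup Finset.card

lemma le_rbRk {W κ : Type*} (c : W → κ) (N : Matroid W) (S : Finset W) (k : κ) (B : Finset W)
    (h1 : B ⊆ S) (h2 : ∀ b ∈ B, c b = k) (h3 : N.Indep (B : Set W)) : B.card ≤ rbRk c N S k := by
  classical
  unfold rbRk
  exact Finset.le_sup (f := Finset.card)
    (Finset.mem_filter.2 ⟨Finset.mem_powerset.2 h1, h2, h3⟩)

lemma exists_rbRk {W κ : Type*} (c : W → κ) (N : Matroid W) (S : Finset W) (k : κ) :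
    ∃ B ⊆ S, (∀ b ∈ B, c b = k) ∧ N.Indep (B : Set W) ∧ B.card = rbRk c N S k := by
  classical
  obtain ⟨B, hB, he⟩ := Finset.exists_mem_eq_sup
    (S.powerset.filter fun B : Finset W => (∀ b ∈ B, c b = k) ∧ N.Indep (B : Set W)) ⟨∅, by simp⟩ Finset.card
  simp only [Finset.mem_filter, Finset.mem_powerset] at hB
  refine ⟨B, hB.1, hB.2.1, hB.2.2, ?_⟩
  rw [← he]
  unfold rbRk
  congr!

lemma rbFill_false (X : Finset W → Prop) (h : ∀ σ, ¬ X σ) (k : ℕ) : RbFillIn X X k := by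
  intro s _ z hz _
  have : z = 0 := by
    funext σ; by_contra hne; exact h σ (hz σ hne).1
  exact ⟨0, by simp, by rw [this]; funext τ; simp [rbBd]⟩

lemma rbX_link {κ : Type*} (c : W → κ) (N : Matroid W) (S C ρ : Finset W) (hC : rbX c N S C) :
    (Disjoint ρ C ∧ rbX c N S (ρ ∪ C)) ↔
      (N ／ (C : Set W)).Indep (ρ : Set W) ∧ ρ ⊆ S ∧ Set.InjOn c (ρ : Set W) ∧
        ∀ v ∈ ρ, ∀ w ∈ C, c v ≠ c w := by
  obtain ⟨c1, c2, c3⟩ := hC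
  rw [c2.contract_indep_iff, Finset.disjoint_coe]
  unfold rbX
  rw [Finset.coe_union, Finset.union_subset_iff]
  constructor
  · rintro ⟨hd, ⟨h1, _⟩, h2, h3⟩
    rw [Set.injOn_union (Finset.disjoint_coe.2 hd)] at h3
    exact ⟨⟨hd, h2⟩, h1, h3.1, h3.2.2⟩
  · rintro ⟨⟨hd, h2⟩, h1, h3, h4⟩
    refine ⟨hd, ⟨h1, c1⟩, h2, ?_⟩
    rw [Set.injOn_union (Finset.disjoint_coe.2 hd)]
    exact ⟨h3, c3, h4⟩

open Classical in
theorem rbE {κ : Type*} [Fintype κ] (c : W → κ) (q : ℕ) : ∀ (N : Matroid W) (S : Finset W),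
    (∀ r, 1 ≤ r → r ≤ q → 2 * q ≤ (Finset.univ.filter fun k => r ≤ rbRk c N S k).card + r) →
    RbFillIn (rbX c N S) (rbX c N S) q := by
  induction q using Nat.strong_induction_on with
  | _ q ih =>
  intro N S hyp
  rcases Nat.eq_zero_or_pos q with rfl | hq
  · intro s hs; exact absurd hs (Nat.not_lt_zero _)
  have hyp1 := hyp 1 le_rfl hq
  obtain ⟨u, hu, humin⟩ := Finset.exists_min_image
    (Finset.univ.filter fun k => 1 ≤ rbRk c N S k) (rbRk c N S)
    (Finset.card_pos.1 (by omega))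
  simp only [Finset.mem_filter, Finset.mem_univ, true_and] at hu humin
  obtain ⟨B, hBS, hBc, hBi, hBcard⟩ := exists_rbRk c N S u
  obtain ⟨x, hxB⟩ : B.Nonempty := Finset.card_pos.1 (by omega)
  have hxi : N.Indep ({x} : Set W) := hBi.subset (by simpa using hxB)
  have hxS := hBS hxB
  have hxu := hBc x hxB
  set S' : Finset W → Finset W := fun C => S.filter fun v => c v ≠ u ∧ ∀ w ∈ C, c v ≠ c w with hS'
  have main : ∀ C : Finset W, N.Indep (C : Set W) → 1 ≤ C.card →
      RbFillIn (rbX c (N ／ (C : Set W)) (S' C)) (rbX c (N ／ (C : Set W)) (S' C)) (q - C.card) := by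
    intro C hCi hC1
    apply ih _ (by omega)
    intro r hr1 hr2
    have hsub : (Finset.univ.filter fun k => r + C.card ≤ rbRk c N S k) \ (insert u (C.image c)) ⊆
        Finset.univ.filter fun k => r ≤ rbRk c (N ／ (C : Set W)) (S' C) k := by
      intro k hk
      simp only [Finset.mem_sdiff, Finset.mem_filter, Finset.mem_univ, true_and,
        Finset.mem_insert, Finset.mem_image, not_or, not_exists, not_and] at hk ⊢
      obtain ⟨hk1, hk2, hk3⟩ := hk
      obtain ⟨A, hAS, hAc, hAi, hAcard⟩ := exists_rbRk c N S k
      obtain ⟨A', hA', hdj, hind, hcard⟩ := rbAug N C A hCi hAi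
      have := le_rbRk c (N ／ (C : Set W)) (S' C) k A' ?_ (fun b hb => hAc b (hA' hb)) ?_
      · omega
      · intro v hv
        simp only [hS', Finset.mem_filter]
        rw [hAc v (hA' hv)]
        exact ⟨hAS (hA' hv), hk2, fun w hw h => hk3 w hw h.symm⟩
      · rw [hCi.contract_indep_iff]
        exact ⟨Finset.disjoint_coe.2 hdj, by simpa using hind⟩
    have hcard := Finset.card_le_card hsub
    have himg := Finset.card_image_le (s := C) (f := c)
    have hA := hyp (r + C.card) (by omega) (by omega)
    by_cases hru : r + C.card ≤ rbRk c N S u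
    · have heq : (Finset.univ.filter fun k => r + C.card ≤ rbRk c N S k)
          = Finset.univ.filter fun k => 1 ≤ rbRk c N S k := by
        ext k
        simp only [Finset.mem_filter, Finset.mem_univ, true_and]
        exact ⟨fun h => by omega, fun h => hru.trans (humin k h)⟩
      rw [heq] at hcard
      have h1 := Finset.le_card_sdiff (insert u (C.image c))
        (Finset.univ.filter fun k => 1 ≤ rbRk c N S k)
      have h2 := Finset.card_insert_le u (C.image c)
      omega
    · have heq : (Finset.univ.filter fun k => r + C.card ≤ rbRk c N S k) \ (insert u (C.image c))
          = (Finset.univ.filter fun k => r + C.card ≤ rbRk c N S k) \ C.image c := by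
        ext k
        simp only [Finset.mem_sdiff, Finset.mem_filter, Finset.mem_univ, true_and,
          Finset.mem_insert, not_or]
        constructor
        · tauto
        · rintro ⟨h1, h2⟩
          exact ⟨h1, fun h => hru (h ▸ h1), h2⟩
      rw [heq] at hcard
      have h1 := Finset.le_card_sdiff (C.image c)
        (Finset.univ.filter fun k => r + C.card ≤ rbRk c N S k)
      omega
  apply rbKey (rbX c N S) (S.filter fun v => c v = u) x (by simp [hxS, hxu]) q
  · rintro σ τ ⟨h1, h2, h3⟩ h
    exact ⟨h.trans h1, h2.subset (by exact_mod_cast h), h3.mono (by exact_mod_cast h)⟩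
  · rintro σ ⟨h1, h2, h3⟩ y hy y' hy' hyσ hyσ'
    simp only [Finset.mem_filter] at hy hy'
    exact h3 hyσ hyσ' (hy.2.trans hy'.2.symm)
  · intro y hy
    simp only [Finset.mem_filter] at hy
    by_cases hyi : N.Indep ({y} : Set W)
    · have := main {y} (by simpa using hyi) (by simp)
      have hX : rbX c N S {y} := ⟨by simpa using hy.1, by simpa using hyi, by simp⟩
      have heq : (fun ρ => y ∉ ρ ∧ rbX c N S (insert y ρ))
          = rbX c (N ／ (({y} : Finset W) : Set W)) (S' {y}) := by
        funext ρ
        have := rbX_link c N S {y} ρ hX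
        rw [Finset.disjoint_singleton_right, Finset.union_comm, ← Finset.insert_eq] at this
        rw [this]
        simp only [rbX, hS', Finset.mem_singleton, forall_eq, hy.2, and_self, eq_iff_iff]
        constructor
        · rintro ⟨h1, h2, h3, h4⟩
          exact ⟨fun v hv => Finset.mem_filter.2 ⟨h2 hv, h4 v hv⟩, h1, h3⟩
        · rintro ⟨h1, h2, h3⟩
          exact ⟨h2, fun v hv => (Finset.mem_filter.1 (h1 hv)).1, h3,
            fun v hv => (Finset.mem_filter.1 (h1 hv)).2⟩
      rw [heq]
      simpa using this
    · apply rbFill_false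
      rintro σ ⟨_, _, h, _⟩
      exact hyi (h.subset (by simp))
  · intro C hCU hC hxC _
    have hC1 : 1 ≤ C.card := by
      rw [Nat.one_le_iff_ne_zero]
      intro h
      rw [Finset.card_eq_zero] at h
      subst h
      exact hxC ⟨by simpa using hxS, by simpa using hxi, by simp⟩
    have := main C hC.2.1 hC1
    have heq : (fun ρ => Disjoint ρ C ∧ Disjoint ρ (S.filter fun v => c v = u) ∧
        rbX c N S (ρ ∪ C)) = rbX c (N ／ (C : Set W)) (S' C) := by
      funext ρ
      have := rbX_link c N S C ρ hC
      rw [and_left_comm, this]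
      simp only [rbX, hS', eq_iff_iff]
      constructor
      · rintro ⟨h0, h1, h2, h3, h4⟩
        refine ⟨fun v hv => Finset.mem_filter.2 ⟨h2 hv, fun h => ?_, h4 v hv⟩, h1, h3⟩
        exact Finset.disjoint_left.1 h0 hv (Finset.mem_filter.2 ⟨h2 hv, h⟩)
      · rintro ⟨h1, h2, h3⟩
        refine ⟨?_, h2, fun v hv => (Finset.mem_filter.1 (h1 hv)).1, h3,
            fun v hv => (Finset.mem_filter.1 (h1 hv)).2.2⟩
        rw [Finset.disjoint_left]
        intro v hv hv'
        exact (Finset.mem_filter.1 (h1 hv)).2.1 (Finset.mem_filter.1 hv').2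
    rw [heq]
    exact this
  · rintro σ C D ⟨s1, s2, s3⟩ hσU hCσ hDσ hC hD hCD
    have hcol : ∀ v ∈ σ, c v ≠ u := fun v hv h =>
      Finset.disjoint_left.1 hσU hv (Finset.mem_filter.2 ⟨s1 hv, h⟩)
    have hxσ : x ∉ σ := fun h => hcol x h hxu
    have key : ∀ E ⊆ σ, (rbX c N S (insert x E) ↔ N.Indep (insert x (E : Set W))) := by
      intro E hE
      refine ⟨fun h => by simpa using h.2.1, fun h => ⟨Finset.insert_subset hxS (hE.trans s1),
        by simpa using h, ?_⟩⟩
      rw [Finset.coe_insert, Set.injOn_insert (fun h => hxσ (hE h))]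
      refine ⟨s3.mono (by exact_mod_cast hE), ?_⟩
      rintro ⟨v, hv, hvx⟩
      exact hcol v (hE hv) (hvx.trans hxu)
    rw [key _ hCσ] at hC
    rw [key _ hDσ] at hD
    rw [key _ (Finset.inter_subset_left.trans hCσ), Finset.coe_inter] at hCD
    refine rbIndepInter N C D x (s2.subset ?_) ?_ hC hD hCD
    · exact Set.union_subset (by exact_mod_cast hCσ) (by exact_mod_cast hDσ)
    · rintro (h | h)
      · exact hxσ (hCσ h)
      · exact hxσ (hDσ h)

/-- Join of a complex with a matroid complex. -/
def rbJ {W : Type*} [DecidableEq W] (X : Finset W → Prop) (K : Matroid W) (T : Finset W)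
    (σ : Finset W) : Prop :=
  X (σ \ T) ∧ K.Indep ((σ ∩ T : Finset W) : Set W)

theorem rbJoin (X : Finset W → Prop) (hdown : ∀ σ τ, X σ → τ ⊆ σ → X τ) (T0 : Finset W)
    (hXT : ∀ σ, X σ → Disjoint σ T0) (a : ℕ) (hX : RbFillIn X X a) (m : ℕ) :
    ∀ (T : Finset W), T ⊆ T0 → T.card = m → ∀ (K : Matroid W) (b : ℕ) (D : Finset W), D ⊆ T →
      K.Indep (D : Set W) → b ≤ D.card → RbFillIn (rbJ X K T) (rbJ X K T) (a + b) := by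
  induction m using Nat.strong_induction_on with
  | _ m ih =>
  intro T hT hTm K b D hDT hD hbD
  by_cases hx : ∃ x ∈ T, K.Indep ({x} : Set W)
  swap
  · push Not at hx
    have hD0 : D = ∅ := by
      rw [Finset.eq_empty_iff_forall_notMem]
      intro x hxD
      exact hx x (hDT hxD) (hD.subset (by simpa using hxD))
    subst hD0
    have hb : b = 0 := by simpa using hbD
    subst hb
    have : rbJ X K T = X := by
      funext σ
      simp only [rbJ, eq_iff_iff]
      constructor
      · rintro ⟨h1, h2⟩
        have : σ ∩ T = ∅ := by
          rw [Finset.eq_empty_iff_forall_notMem]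
          intro x hxD
          exact hx x (Finset.mem_inter.1 hxD).2 (h2.subset (by simpa using hxD))
        rwa [Finset.sdiff_eq_self_iff_disjoint.2 (Finset.disjoint_iff_inter_eq_empty.2 this)] at h1
      · intro h
        have hd := Finset.disjoint_of_subset_right hT (hXT σ h)
        rw [Finset.sdiff_eq_self_iff_disjoint.2 hd, Finset.disjoint_iff_inter_eq_empty.1 hd]
        exact ⟨h, by simp⟩
    rw [this]
    simpa using hX
  obtain ⟨x, hxT, hxi⟩ := hx
  have hrec : ∀ C : Finset W, C ⊆ T → K.Indep (C : Set W) →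
      (x ∈ C ∨ ¬ K.Indep (insert x (C : Set W))) →
      RbFillIn (rbJ X (K ／ (C : Set W)) (T \ insert x C)) (rbJ X (K ／ (C : Set W)) (T \ insert x C))
        (a + b - C.card) := by
    intro C hCT hCi hxC
    obtain ⟨D', hD', hdj, hind, hcard⟩ := rbAug K C D hCi hD
    have hlt : (T \ insert x C).card < m := by
      rw [← hTm]
      apply Finset.card_lt_card
      refine ⟨Finset.sdiff_subset, fun h => ?_⟩
      have := h hxT
      simp at this
    refine (ih _ hlt _ (Finset.sdiff_subset.trans hT) rfl (K ／ (C : Set W)) (b - C.card) D' ?_ ?_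
      (by omega)).mono (by omega)
    · intro v hv
      rw [Finset.mem_sdiff, Finset.mem_insert]
      refine ⟨hDT (hD' hv), ?_⟩
      rintro (rfl | h)
      · rcases hxC with h | h
        · exact Finset.disjoint_left.1 hdj hv h
        · apply h
          refine hind.subset ?_
          rw [Finset.coe_union]
          exact Set.insert_subset (Or.inl hv) Set.subset_union_right
      · exact Finset.disjoint_left.1 hdj hv h
    · rw [hCi.contract_indep_iff]
      exact ⟨Finset.disjoint_coe.2 hdj, by simpa using hind⟩
  -- description of the links
  have hlink : ∀ C ρ : Finset W, C ⊆ T → K.Indep (C : Set W) →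
      ((Disjoint ρ (insert x C) ∧ X (ρ \ T) ∧ K.Indep ((ρ ∩ T ∪ C : Finset W) : Set W)) ↔
        rbJ X (K ／ (C : Set W)) (T \ insert x C) ρ) := by
    intro C ρ hCT hCi
    have hin : insert x C ⊆ T := Finset.insert_subset hxT hCT
    have aux : Disjoint ρ (insert x C) → ρ \ (T \ insert x C) = ρ \ T ∧
        ρ ∩ (T \ insert x C) = ρ ∩ T := by
      intro h
      rw [Finset.disjoint_left] at h
      constructor
      · ext v
        have := @h v
        simp only [Finset.mem_sdiff]
        tauto
      · ext v
        have := @h v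
        simp only [Finset.mem_sdiff, Finset.mem_inter]
        tauto
    unfold rbJ
    rw [hCi.contract_indep_iff]
    constructor
    · rintro ⟨h1, h2, h3⟩
      rw [(aux h1).1, (aux h1).2]
      refine ⟨h2, ?_, by simpa using h3⟩
      rw [Finset.disjoint_coe]
      exact Finset.disjoint_of_subset_left Finset.inter_subset_left
        (Finset.disjoint_of_subset_right (Finset.subset_insert _ _) h1)
    · rintro ⟨h1, h2, h3⟩
      have hd : Disjoint ρ (insert x C) := by
        rw [Finset.disjoint_left]
        intro v hv hv'
        have hvm : v ∈ ρ \ (T \ insert x C) := by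
          simp only [Finset.mem_sdiff]; tauto
        exact Finset.disjoint_left.1 (hXT _ h1) hvm (hT (hin hv'))
      rw [(aux hd).1] at h1
      rw [(aux hd).2] at h3
      exact ⟨hd, h1, by simpa using h3⟩
  have hJx : ∀ E : Finset W, (rbJ X K T (insert x E) ↔
      X (E \ T) ∧ K.Indep (insert x ((E ∩ T : Finset W) : Set W))) := by
    intro E
    unfold rbJ
    rw [Finset.insert_sdiff_of_mem _ hxT, Finset.insert_inter_of_mem hxT, Finset.coe_insert]
  apply rbKey (rbJ X K T) {x} x (Finset.mem_singleton_self _) (a + b)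
  · rintro σ τ ⟨h1, h2⟩ h
    refine ⟨hdown _ _ h1 (Finset.sdiff_subset_sdiff h (Finset.Subset.refl _)), h2.subset ?_⟩
    exact_mod_cast Finset.inter_subset_inter_right h
  · intro σ _ y hy y' hy' _ _
    rw [Finset.mem_singleton] at hy hy'
    rw [hy, hy']
  · intro y hy
    rw [Finset.mem_singleton] at hy
    subst hy
    have h1 := hrec {y} (by simpa using hxT) (by simpa using hxi) (Or.inl (by simp))
    have heq : (fun ρ => y ∉ ρ ∧ rbJ X K T (insert y ρ))
        = rbJ X (K ／ (({y} : Finset W) : Set W)) (T \ insert y {y}) := by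
      funext ρ
      rw [← hlink {y} ρ (by simpa using hxT) (by simpa using hxi), hJx]
      simp
    rw [heq]
    simpa using h1
  · intro C hCx hC hxC hmin
    have hCT : C ⊆ T := by
      by_contra hn
      have := hmin (C ∩ T) ⟨Finset.inter_subset_left, fun h =>
        hn (h.trans Finset.inter_subset_right)⟩
      rw [hJx] at this hxC
      apply hxC
      refine ⟨hC.1, ?_⟩
      have h2 := this.2
      rwa [Finset.inter_assoc, Finset.inter_self] at h2
    have hCi : K.Indep (C : Set W) := by
      have := hC.2
      rwa [Finset.inter_eq_left.2 hCT] at this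
    have hnd : ¬ K.Indep (insert x (C : Set W)) := by
      intro h
      apply hxC
      rw [hJx, Finset.inter_eq_left.2 hCT]
      exact ⟨hC.1, h⟩
    have h1 := hrec C hCT hCi (Or.inr hnd)
    have heq : (fun ρ => Disjoint ρ C ∧ Disjoint ρ {x} ∧ rbJ X K T (ρ ∪ C))
        = rbJ X (K ／ (C : Set W)) (T \ insert x C) := by
      funext ρ
      rw [← hlink C ρ hCT hCi]
      unfold rbJ
      rw [Finset.union_sdiff_distrib, Finset.sdiff_eq_empty_iff_subset.2 hCT, Finset.union_empty,
        Finset.union_inter_distrib_right, Finset.inter_eq_left.2 hCT, Finset.disjoint_insert_right,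
        Finset.disjoint_singleton_right, eq_iff_iff]
      tauto
    rw [heq]
    exact h1
  · rintro σ C D ⟨s1, s2⟩ hσU hCσ hDσ hC hD hCD
    have hxσ : x ∉ σ := Finset.disjoint_singleton_right.1 hσU
    have hsd : ∀ E ⊆ σ, X (E \ T) := fun E hE =>
      hdown _ _ s1 (Finset.sdiff_subset_sdiff hE (Finset.Subset.refl _))
    rw [hJx, and_iff_right (hsd _ hCσ)] at hC
    rw [hJx, and_iff_right (hsd _ hDσ)] at hD
    rw [hJx, and_iff_right (hsd _ (Finset.inter_subset_left.trans hCσ)),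
      Finset.inter_inter_distrib_right, Finset.coe_inter] at hCD
    refine rbIndepInter K _ _ x (s2.subset ?_) ?_ hC hD hCD
    · rw [← Finset.coe_union, ← Finset.union_inter_distrib_right]
      exact_mod_cast Finset.inter_subset_inter_right (Finset.union_subset hCσ hDσ)
    · rintro (h | h)
      · exact hxσ (hCσ (Finset.mem_inter.1 h).1)
      · exact hxσ (hDσ (Finset.mem_inter.1 h).1)

end matroids

section sperner
variable {V W : Type*} [Fintype V] [DecidableEq V] [Fintype W] [DecidableEq W]

lemma rbChains (Y : Finset V → Finset W → Prop)
    (hfill : ∀ A, RbFillIn (Y A) (Y A) A.card)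
    (hmono : ∀ A B σ, A ⊆ B → Y A σ → Y B σ) (h0 : Y ∅ ∅) (m : ℕ) :
    ∃ c : Finset V → Finset W → ZMod 2, c ∅ = (fun σ => if σ = ∅ then 1 else 0) ∧
      (∀ A, A.card ≤ m → ∀ σ, c A σ ≠ 0 → Y A σ ∧ σ.card = A.card) ∧
      (∀ A, A.card ≤ m → rbBd (c A) = ∑ v ∈ A, c (A.erase v)) := by
  classical
  induction m with
  | zero =>
    refine ⟨fun _ σ => if σ = ∅ then 1 else 0, rfl, ?_, ?_⟩
    · intro A hA σ hσ
      have hA0 : A = ∅ := by simpa using hA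
      subst hA0
      have : σ = ∅ := by
        by_contra h; simp [h] at hσ
      subst this
      exact ⟨h0, rfl⟩
    · intro A hA
      have hA0 : A = ∅ := by simpa using hA
      subst hA0
      funext τ
      simp [rbBd]
  | succ m ih =>
    obtain ⟨c, c0, c1, c2⟩ := ih
    have hex : ∀ A : Finset V, ∃ w : Finset W → ZMod 2, A.card = m + 1 →
        (∀ σ, w σ ≠ 0 → Y A σ ∧ σ.card = m + 1) ∧ rbBd w = ∑ v ∈ A, c (A.erase v) := by
      intro A
      by_cases hA : A.card = m + 1
      swap
      · exact ⟨0, fun h => absurd h hA⟩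
      have hcard : ∀ v ∈ A, (A.erase v).card = m := fun v hv => by
        rw [Finset.card_erase_of_mem hv, hA]; rfl
      have hz1 : ∀ σ, (∑ v ∈ A, c (A.erase v)) σ ≠ 0 → Y A σ ∧ σ.card = m := by
        intro σ hσ
        rw [Finset.sum_apply] at hσ
        obtain ⟨v, hv, hne⟩ := Finset.exists_ne_zero_of_sum_ne_zero hσ
        have := c1 (A.erase v) (hcard v hv).le σ hne
        exact ⟨hmono _ _ _ (Finset.erase_subset _ _) this.1, this.2.trans (hcard v hv)⟩
      have hz2 : rbBd (∑ v ∈ A, c (A.erase v)) = 0 := by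
        rw [rbBd_sum]
        funext τ
        have := rb_sum_pairs A (fun v u => c ((A.erase v).erase u) τ)
          (fun u v => by rw [Finset.erase_right_comm])
        rw [Finset.sum_apply, Pi.zero_apply, ← this]
        refine Finset.sum_congr rfl fun v hv => ?_
        rw [c2 _ (hcard v hv).le, Finset.sum_apply]
      obtain ⟨w, hw⟩ := hfill A m (by omega) (∑ v ∈ A, c (A.erase v)) hz1 hz2
      exact ⟨w, fun _ => hw⟩
    choose w hw using hex
    refine ⟨fun A => if A.card = m + 1 then w A else c A, by simpa using c0, ?_, ?_⟩
    · intro A hA σ hσ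
      by_cases h : A.card = m + 1
      · simp only [h, if_true] at hσ
        rw [h]; exact (hw A h).1 σ hσ
      · simp only [h, if_false] at hσ
        exact c1 A (by omega) σ hσ
    · intro A hA
      have hsub : ∀ v ∈ A, (A.erase v).card ≠ m + 1 := fun v hv => by
        rw [Finset.card_erase_of_mem hv]
        have := Finset.card_pos.2 ⟨v, hv⟩
        omega
      have hs : ∑ v ∈ A, (fun A : Finset V => if A.card = m + 1 then w A else c A) (A.erase v)
          = ∑ v ∈ A, c (A.erase v) :=
        Finset.sum_congr rfl fun v hv => by simp only [hsub v hv, if_false]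
      rw [hs]
      by_cases h : A.card = m + 1
      · simp only [h, if_true]
        exact (hw A h).2
      · simp only [h, if_false]
        exact c2 A (by omega)

lemma rb_double (f : Finset W → ZMod 2) (P : Finset W → Prop) [DecidablePred P] :
    ∑ τ ∈ Finset.univ.filter P, rbBd f τ
      = ∑ σ, ((σ.filter fun w => P (σ.erase w)).card : ZMod 2) * f σ := by
  have h1 : ∑ τ ∈ Finset.univ.filter P, rbBd f τ
      = ∑ p ∈ (Finset.univ.filter P).sigma (fun τ => τᶜ), f (insert p.2 p.1) := by
    rw [Finset.sum_sigma]; rfl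
  have h2 : ∑ σ, ((σ.filter fun w => P (σ.erase w)).card : ZMod 2) * f σ
      = ∑ p ∈ (Finset.univ : Finset (Finset W)).sigma (fun σ => σ.filter fun w => P (σ.erase w)),
          f p.1 := by
    rw [Finset.sum_sigma]
    refine Finset.sum_congr rfl fun σ _ => ?_
    simp
  rw [h1, h2]
  refine Finset.sum_bij' (fun p _ => ⟨insert p.2 p.1, p.2⟩) (fun p _ => ⟨p.1.erase p.2, p.2⟩)
    ?_ ?_ ?_ ?_ ?_
  · rintro ⟨τ, w⟩ h
    simp only [Finset.mem_sigma, Finset.mem_filter, Finset.mem_univ, true_and,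
      Finset.mem_compl] at h ⊢
    rw [Finset.erase_insert h.2]
    exact ⟨Finset.mem_insert_self _ _, h.1⟩
  · rintro ⟨σ, w⟩ h
    simp only [Finset.mem_sigma, Finset.mem_filter, Finset.mem_univ, true_and,
      Finset.mem_compl] at h ⊢
    exact ⟨h.2, by simp⟩
  · rintro ⟨τ, w⟩ h
    simp only [Finset.mem_sigma, Finset.mem_filter, Finset.mem_univ, true_and,
      Finset.mem_compl] at h
    simp [Finset.erase_insert h.2]
  · rintro ⟨σ, w⟩ h
    simp only [Finset.mem_sigma, Finset.mem_filter, Finset.mem_univ, true_and,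
      Finset.mem_compl] at h
    simp [Finset.insert_erase h.1]
  · rintro ⟨τ, w⟩ h
    rfl

lemma rb_count (π : W → V) (σ : Finset W) (A : Finset V) (a : V) (ha : a ∉ A)
    (hcard : σ.card = A.card + 1) (hsub : σ.image π ⊆ insert a A) :
    ((σ.filter fun w => (σ.erase w).image π = A).card : ZMod 2)
      = if σ.image π = insert a A then 1 else 0 := by
  by_cases h1 : σ.image π = insert a A
  · rw [if_pos h1]
    have hinj : Set.InjOn π (σ : Set W) := by
      rw [← Finset.card_image_iff, h1, Finset.card_insert_of_notMem ha, hcard]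
    obtain ⟨w, hw, hwa⟩ := Finset.mem_image.1 (h1 ▸ Finset.mem_insert_self a A)
    have : (σ.filter fun w => (σ.erase w).image π = A) = {w} := by
      ext v
      simp only [Finset.mem_filter, Finset.mem_singleton]
      constructor
      · rintro ⟨hv, hvA⟩
        by_contra hne
        apply ha
        rw [← hvA, ← hwa]
        exact Finset.mem_image_of_mem _ (Finset.mem_erase.2 ⟨fun h => hne h.symm, hw⟩)
      · rintro rfl
        refine ⟨hw, ?_⟩
        ext b
        constructor
        · intro hb
          obtain ⟨u, hu, rfl⟩ := Finset.mem_image.1 hb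
          have hu' := Finset.mem_erase.1 hu
          have := hsub (Finset.mem_image_of_mem π hu'.2)
          rcases Finset.mem_insert.1 this with h | h
          · exact absurd (hinj hu'.2 hw (h.trans hwa.symm)) hu'.1
          · exact h
        · intro hb
          obtain ⟨u, hu, rfl⟩ := Finset.mem_image.1 (h1 ▸ Finset.mem_insert_of_mem hb)
          refine Finset.mem_image_of_mem _ (Finset.mem_erase.2 ⟨?_, hu⟩)
          rintro rfl
          exact ha (hwa ▸ hb)
    rw [this]; simp
  rw [if_neg h1]
  by_cases h2 : σ.image π = A
  · obtain ⟨w1, hw1, w2, hw2, hne, heq⟩ := Finset.exists_ne_map_eq_of_card_lt_of_maps_to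
      (s := σ) (t := A) (by omega) (f := π)
      (fun w hw => Finset.mem_coe.2 (h2 ▸ Finset.mem_image_of_mem π hw))
    have key : ∀ u v, u ∈ σ → v ∈ σ → u ≠ v → π u = π v → (σ.erase u).image π = A := by
      intro u v hu hv huv h
      rw [← h2]
      ext b
      simp only [Finset.mem_image, Finset.mem_erase]
      constructor
      · rintro ⟨t, ⟨_, h⟩, h'⟩; exact ⟨t, h, h'⟩
      · rintro ⟨t, ht, h'⟩
        by_cases htu : t = u
        · exact ⟨v, ⟨huv.symm, hv⟩, by rw [← h', htu, h]⟩
        · exact ⟨t, ⟨htu, ht⟩, h'⟩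
    have : (σ.filter fun w => (σ.erase w).image π = A) = {w1, w2} := by
      ext v
      simp only [Finset.mem_filter, Finset.mem_singleton, Finset.mem_insert]
      constructor
      · rintro ⟨hv, hvA⟩
        by_contra hn
        push Not at hn
        have hinj : Set.InjOn π ((σ.erase v : Finset W) : Set W) := by
          rw [← Finset.card_image_iff, hvA, Finset.card_erase_of_mem hv, hcard]; rfl
        refine hne (hinj ?_ ?_ heq)
        · exact Finset.mem_coe.2 (Finset.mem_erase.2 ⟨hn.1.symm, hw1⟩)
        · exact Finset.mem_coe.2 (Finset.mem_erase.2 ⟨hn.2.symm, hw2⟩)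
      · rintro (rfl | rfl)
        · exact ⟨hw1, key _ _ hw1 hw2 hne heq⟩
        · exact ⟨hw2, key _ _ hw2 hw1 hne.symm heq.symm⟩
    rw [this, Finset.card_pair hne]
    rfl
  · have : (σ.filter fun w => (σ.erase w).image π = A) = ∅ := by
      rw [Finset.filter_eq_empty_iff]
      intro w hw hwA
      have hA : A ⊆ σ.image π := hwA ▸ Finset.image_subset_image (Finset.erase_subset _ _)
      by_cases haσ : a ∈ σ.image π
      · exact h1 (Finset.Subset.antisymm hsub (Finset.insert_subset haσ hA))
      · refine h2 (Finset.Subset.antisymm (fun b hb => ?_) hA)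
        rcases Finset.mem_insert.1 (hsub hb) with rfl | h
        · exact absurd hb haσ
        · exact h
    rw [this]; simp

theorem rbSperner (π : W → V) (Y : Finset V → Finset W → Prop)
    (hfill : ∀ A, RbFillIn (Y A) (Y A) A.card)
    (hmono : ∀ A B σ, A ⊆ B → Y A σ → Y B σ) (h0 : Y ∅ ∅)
    (hπ : ∀ A σ, Y A σ → σ.image π ⊆ A) :
    ∃ σ, Y Finset.univ σ ∧ σ.card = Fintype.card V ∧ σ.image π = Finset.univ := by
  classical
  obtain ⟨c, c0, c1, c2⟩ := rbChains Y hfill hmono h0 (Fintype.card V)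
  have c1' := fun A => c1 A (Finset.card_le_univ A)
  have c2' := fun A => c2 A (Finset.card_le_univ A)
  have hN : ∀ A : Finset V, ∑ σ ∈ Finset.univ.filter (fun σ : Finset W => σ.image π = A), c A σ
      = 1 := by
    intro A
    induction A using Finset.induction_on with
    | empty =>
      have : (Finset.univ.filter (fun σ : Finset W => σ.image π = ∅)) = {∅} := by
        ext σ; simp
      rw [this, c0]; simp
    | insert a A ha ih =>
      have h := rb_double (c (insert a A)) (fun τ => τ.image π = A)
      rw [c2'] at h
      have hL : ∑ τ ∈ Finset.univ.filter (fun τ : Finset W => τ.image π = A),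
          (∑ v ∈ insert a A, c ((insert a A).erase v)) τ = 1 := by
        rw [← ih]
        refine Finset.sum_congr rfl fun τ hτ => ?_
        rw [Finset.sum_apply, Finset.sum_insert ha, Finset.erase_insert ha]
        rw [Finset.sum_eq_zero, add_zero]
        intro v hv
        by_contra hne
        have h1 := hπ _ _ (c1' _ τ hne).1
        rw [(Finset.mem_filter.1 hτ).2] at h1
        exact absurd (h1 hv) (by simp)
      rw [hL] at h
      rw [h, Finset.sum_filter]
      refine Finset.sum_congr rfl fun σ _ => ?_
      by_cases hne : c (insert a A) σ = 0
      · simp [hne]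
      · have := c1' _ σ hne
        rw [rb_count π σ A a ha (by rw [this.2, Finset.card_insert_of_notMem ha]) (hπ _ _ this.1)]
        split_ifs <;> simp
  have h1 : ∑ σ ∈ Finset.univ.filter (fun σ : Finset W => σ.image π = Finset.univ),
      c Finset.univ σ ≠ 0 := by rw [hN]; exact one_ne_zero
  obtain ⟨σ, hσ, hne⟩ := Finset.exists_ne_zero_of_sum_ne_zero h1
  have := c1' _ σ hne
  exact ⟨σ, this.1, this.2, (Finset.mem_filter.1 hσ).2⟩

end sperner

section assembly

/-- Truncation of a matroid on a finite type. -/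
def rbTrunc {V : Type*} [Finite V] (M : Matroid V) (n : ℕ) : Matroid V :=
  (IndepMatroid.ofFinite (E := Set.univ) (Set.toFinite _)
    (fun I => M.Indep I ∧ I.ncard ≤ n) ⟨M.empty_indep, by simp⟩
    (fun I J hJ hIJ => ⟨hJ.1.subset hIJ, (Set.ncard_le_ncard hIJ (Set.toFinite _)).trans hJ.2⟩)
    (by
      intro I J hI hJ hlt
      have hc : I.encard < J.encard := by
        rw [← (Set.toFinite I).cast_ncard_eq, ← (Set.toFinite J).cast_ncard_eq]
        exact_mod_cast hlt
      obtain ⟨e, he, hi⟩ := hI.1.augment hJ.1 hc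
      refine ⟨e, he.1, he.2, hi, ?_⟩
      rw [Set.ncard_insert_of_notMem he.2 (Set.toFinite _)]
      have := hJ.2
      omega)
    (fun I _ => Set.subset_univ I)).matroid

lemma rbTrunc_indep {V : Type*} [Finite V] (M : Matroid V) (n : ℕ) (I : Set V) :
    (rbTrunc M n).Indep I ↔ M.Indep I ∧ I.ncard ≤ n := by
  simp [rbTrunc]

lemma rbTrunc_E {V : Type*} [Finite V] (M : Matroid V) (n : ℕ) :
    (rbTrunc M n).E = Set.univ := by
  simp [rbTrunc]

lemma rbTrunc_base {V : Type*} [Finite V] (M : Matroid V) (n : ℕ) (P : Set V)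
    (hP : M.Indep P) (hPn : P.ncard = n) (B : Set V) (hB : (rbTrunc M n).IsBase B) :
    M.Indep B ∧ B.ncard = n := by
  have hBi := (rbTrunc_indep M n B).1 hB.indep
  refine ⟨hBi.1, le_antisymm hBi.2 ?_⟩
  by_contra hlt
  have hPT : (rbTrunc M n).Indep P := (rbTrunc_indep M n P).2 ⟨hP, hPn.le⟩
  have hc : B.encard < P.encard := by
    rw [← (Set.toFinite B).cast_ncard_eq, ← (Set.toFinite P).cast_ncard_eq]
    exact_mod_cast (by omega : B.ncard < P.ncard)
  obtain ⟨e, he, hi⟩ := hB.indep.augment hPT hc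
  have := hB.eq_of_subset_indep hi (Set.subset_insert _ _)
  exact he.2 (this ▸ Set.mem_insert e B)

variable {V : Type*} [Fintype V] [DecidableEq V]

/-- The complexes fed to the Sperner-type lemma. -/
def rbY {κ : Type*} (c : V → κ) (N K : Matroid V) (A : Finset V) : Finset (V × Bool) → Prop :=
  rbJ (rbX (fun w : V × Bool => c w.1) (N.comap Prod.fst) (A ×ˢ {true})) (K.comap Prod.fst)
    (A ×ˢ {false})

lemma rbY_iff {κ : Type*} (c : V → κ) (N K : Matroid V) (A : Finset V) (σ : Finset (V × Bool)) :
    rbY c N K A σ ↔ (∀ w ∈ σ, w.1 ∈ A) ∧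
      (N.comap Prod.fst).Indep ((σ.filter fun w => w.2 = true : Finset (V × Bool)) : Set (V × Bool)) ∧
      Set.InjOn (fun w : V × Bool => c w.1)
        ((σ.filter fun w => w.2 = true : Finset (V × Bool)) : Set (V × Bool)) ∧
      (K.comap Prod.fst).Indep
        ((σ.filter fun w => w.2 = false : Finset (V × Bool)) : Set (V × Bool)) := by
  have key : (∀ w ∈ σ, w.1 ∈ A) → σ \ (A ×ˢ {false}) = (σ.filter fun w => w.2 = true) ∧
      σ ∩ (A ×ˢ {false}) = (σ.filter fun w => w.2 = false) := by
    intro h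
    constructor
    · ext ⟨v, b⟩
      have := h (v, b)
      cases b <;> simp <;> tauto
    · ext ⟨v, b⟩
      have := h (v, b)
      cases b <;> simp <;> tauto
  unfold rbY rbJ rbX
  constructor
  · rintro ⟨⟨h1, h2, h3⟩, h4⟩
    have h : ∀ w ∈ σ, w.1 ∈ A := by
      intro w hw
      by_cases hw' : w ∈ A ×ˢ ({false} : Finset Bool)
      · exact (Finset.mem_product.1 hw').1
      · exact (Finset.mem_product.1 (h1 (Finset.mem_sdiff.2 ⟨hw, hw'⟩))).1
    rw [(key h).1] at h2 h3
    rw [(key h).2] at h4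
    exact ⟨h, h2, h3, h4⟩
  · rintro ⟨h, h2, h3, h4⟩
    rw [(key h).1, (key h).2]
    refine ⟨⟨?_, h2, h3⟩, h4⟩
    intro w hw
    rw [Finset.mem_filter] at hw
    exact Finset.mem_product.2 ⟨h w hw.1, by simpa using hw.2⟩

lemma rbRk_prod {κ : Type*} (c : V → κ) (N : Matroid V) (A : Finset V) (k : κ) :
    rbRk c N A k ≤ rbRk (fun w : V × Bool => c w.1) (N.comap Prod.fst) (A ×ˢ {true}) k := by
  obtain ⟨B, h1, h2, h3, h4⟩ := exists_rbRk c N A k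
  rw [← h4]
  have := le_rbRk (fun w : V × Bool => c w.1) (N.comap Prod.fst) (A ×ˢ {true}) k (B ×ˢ {true})
    (Finset.product_subset_product_left h1) ?_ ?_
  · simpa using this
  · rintro ⟨v, b⟩ hb
    exact h2 v (Finset.mem_product.1 hb).1
  · rw [Matroid.comap_indep_iff]
    constructor
    · refine h3.subset ?_
      rintro _ ⟨⟨v, b⟩, hb, rfl⟩
      exact (Finset.mem_product.1 (Finset.mem_coe.1 hb)).1
    · rintro ⟨v, b⟩ hb ⟨v', b'⟩ hb' h
      have e1 := (Finset.mem_product.1 (Finset.mem_coe.1 hb)).2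
      have e2 := (Finset.mem_product.1 (Finset.mem_coe.1 hb')).2
      simp only [Finset.mem_singleton] at e1 e2 h
      rw [h, e1, e2]

open Classical in
theorem rbMain {κ : Type*} [Fintype κ] (c : V → κ) (M N : Matroid V) (n : ℕ)
    (P : Finset V) (hP : M.Indep (P : Set V)) (hPn : P.card = n)
    (H : ∀ (A : Finset V) (m : ℕ), m < n →
      (∀ I : Finset V, Disjoint I A → M.Indep (I : Set V) → I.card ≤ m) →
      ∀ r, 1 ≤ r → r ≤ n - m →
        2 * (n - m) ≤ (Finset.univ.filter fun k => r ≤ rbRk c N A k).card + r) :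
    ∃ B : Finset V, B.card = n ∧ M.Indep (B : Set V) ∧ N.Indep (B : Set V) ∧
      Set.InjOn c (B : Set V) := by
  set T := rbTrunc M n with hT
  have hbase : ∀ B, T.IsBase B → M.Indep B ∧ B.ncard = n :=
    rbTrunc_base M n P hP (by rw [Set.ncard_coe_finset, hPn])
  have hfill : ∀ A : Finset V, RbFillIn (rbY c N T✶ A) (rbY c N T✶ A) A.card := by
    intro A
    obtain ⟨I, hI, hmax⟩ := Finset.exists_max_image
      (Finset.univ.filter fun I : Finset V => Disjoint I A ∧ M.Indep (I : Set V) ∧ I.card ≤ n)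
      Finset.card ⟨∅, by simp⟩
    simp only [Finset.mem_filter, Finset.mem_univ, true_and] at hI hmax
    obtain ⟨hIA, hIM, hIn⟩ := hI
    have hIT : T.Indep (I : Set V) := (rbTrunc_indep M n _).2 ⟨hIM, by simpa using hIn⟩
    obtain ⟨B0, hB0, hIB0⟩ := hIT.exists_isBase_superset
    obtain ⟨B, rfl⟩ : ∃ B : Finset V, (B : Set V) = B0 := ⟨B0.toFinset, by simp⟩
    have hBn := (hbase _ hB0).2
    rw [Set.ncard_coe_finset] at hBn
    have hIB : I ⊆ B := by exact_mod_cast hIB0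
    have hX : RbFillIn (rbX (fun w : V × Bool => c w.1) (N.comap Prod.fst) (A ×ˢ {true}))
        (rbX (fun w : V × Bool => c w.1) (N.comap Prod.fst) (A ×ˢ {true})) (n - I.card) := by
      apply rbE
      intro r hr1 hr2
      have hlt : I.card < n := by omega
      refine (H A I.card hlt ?_ r hr1 hr2).trans (Nat.add_le_add_right (Finset.card_le_card ?_) r)
      · intro J hJA hJM
        by_contra hJ
        push Not at hJ
        obtain ⟨J', hJ', hJc⟩ := Finset.exists_subset_card_eq (show I.card + 1 ≤ J.card by omega)
        have := hmax J' ⟨Finset.disjoint_of_subset_left hJ' hJA,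
          hJM.subset (by exact_mod_cast hJ'), by omega⟩
        omega
      · intro k hk
        rw [Finset.mem_filter] at hk ⊢
        exact ⟨hk.1, hk.2.trans (rbRk_prod c N A k)⟩
    have hJ := rbJoin (rbX (fun w : V × Bool => c w.1) (N.comap Prod.fst) (A ×ˢ {true}))
      (by
        rintro σ τ ⟨h1, h2, h3⟩ h
        exact ⟨h.trans h1, h2.subset (by exact_mod_cast h), h3.mono (by exact_mod_cast h)⟩)
      (A ×ˢ {false})
      (by
        rintro σ ⟨h1, -, -⟩
        refine Finset.disjoint_of_subset_left h1 ?_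
        rw [Finset.disjoint_left]
        rintro ⟨v, b⟩ h h'
        have e1 := (Finset.mem_product.1 h).2
        have e2 := (Finset.mem_product.1 h').2
        simp only [Finset.mem_singleton] at e1 e2
        rw [e1] at e2
        exact absurd e2 (by decide))
      (n - I.card) hX _ (A ×ˢ {false}) (Finset.Subset.refl _) rfl (T✶.comap Prod.fst)
      (A \ B).card ((A \ B) ×ˢ {false}) (Finset.product_subset_product_left Finset.sdiff_subset)
      (by
        rw [Matroid.comap_indep_iff]
        constructor
        · rw [Matroid.dual_indep_iff_exists']
          refine ⟨by rw [hT, rbTrunc_E]; exact Set.subset_univ _, (B : Set V), hB0, ?_⟩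
          rw [Set.disjoint_left]
          rintro _ ⟨⟨v, b⟩, hb, rfl⟩ hv
          have := (Finset.mem_product.1 (Finset.mem_coe.1 hb)).1
          exact (Finset.mem_sdiff.1 this).2 hv
        · rintro ⟨v, b⟩ hb ⟨v', b'⟩ hb' h
          have e1 := (Finset.mem_product.1 (Finset.mem_coe.1 hb)).2
          have e2 := (Finset.mem_product.1 (Finset.mem_coe.1 hb')).2
          simp only [Finset.mem_singleton] at e1 e2 h
          rw [h, e1, e2])
      (by simp)
    refine RbFillIn.mono hJ ?_
    have h1 : I.card ≤ (B \ A).card := by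
      apply Finset.card_le_card
      intro v hv
      exact Finset.mem_sdiff.2 ⟨hIB hv, Finset.disjoint_left.1 hIA hv⟩
    have h2 := Finset.card_sdiff_add_card_inter A B
    have h3 := Finset.card_sdiff_add_card_inter B A
    rw [Finset.inter_comm] at h3
    omega
  obtain ⟨σ, hσ, -, hσi⟩ := rbSperner (Prod.fst : V × Bool → V) (rbY c N T✶) hfill
    (by
      intro A B σ hAB h
      rw [rbY_iff] at h ⊢
      exact ⟨fun w hw => hAB (h.1 w hw), h.2⟩)
    (by rw [rbY_iff]; simp)
    (by
      intro A σ h v hv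
      rw [rbY_iff] at h
      obtain ⟨w, hw, rfl⟩ := Finset.mem_image.1 hv
      exact h.1 w hw)
  rw [rbY_iff] at hσ
  obtain ⟨-, hσN, hσc, hσK⟩ := hσ
  rw [Matroid.comap_indep_iff] at hσN hσK
  obtain ⟨-, B0, hB0, hdisj⟩ := (Matroid.dual_indep_iff_exists' ).1 hσK.1
  obtain ⟨B, rfl⟩ : ∃ B : Finset V, (B : Set V) = B0 := ⟨B0.toFinset, by simp⟩
  have hb := hbase _ hB0
  rw [Set.ncard_coe_finset] at hb
  have hsub : ∀ v ∈ B, (v, true) ∈ σ := by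
    intro v hv
    have : v ∈ σ.image Prod.fst := hσi ▸ Finset.mem_univ v
    obtain ⟨⟨v', b⟩, hw, rfl⟩ := Finset.mem_image.1 this
    cases b with
    | true => exact hw
    | false =>
      exfalso
      exact Set.disjoint_left.1 hdisj ⟨(v', false), by simpa using hw, rfl⟩ hv
  refine ⟨B, hb.2, hb.1, hσN.1.subset ?_, ?_⟩
  · intro v hv
    exact ⟨(v, true), by simpa using hsub v hv, rfl⟩
  · intro v hv v' hv' h
    have := @hσc (v, true) (by simpa using hsub v hv) (v', true) (by simpa using hsub v' hv') h
    exact congrArg Prod.fst this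

end assembly

/-- **Main theorem.** Let `M` and `N` be two matroids on the same ground set, and let
`A 0, …, A (2n-2)` be sets independent in both `M` and `N` with `|A i| ≥ min(i+1, n)`
(`i` is 0-indexed). Then there is a partial rainbow set of size `n` — i.e. strictly
increasing indices and distinct representatives — independent in both `M` and `N`. -/
theorem main_theorem {α : Type*} (M N : Matroid α) (n : ℕ)
    (A : Fin (2 * n - 1) → Finset α)
    (hM : ∀ i, M.Indep (A i : Set α)) (hN : ∀ i, N.Indep (A i : Set α))
    (hcard : ∀ i : Fin (2 * n - 1), min (i.1 + 1) n ≤ (A i).card) :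
    ∃ (ι : Fin n → Fin (2 * n - 1)) (x : Fin n → α),
      StrictMono ι ∧ Function.Injective x ∧ (∀ j, x j ∈ A (ι j)) ∧
        M.Indep (Set.range x) ∧ N.Indep (Set.range x) := by
  classical
  rcases Nat.eq_zero_or_pos n with rfl | hn
  · refine ⟨Fin.elim0, Fin.elim0, fun i => i.elim0, fun i => i.elim0, fun i => i.elim0, ?_, ?_⟩
    · rw [Set.range_eq_empty]; exact M.empty_indep
    · rw [Set.range_eq_empty]; exact N.empty_indep
  let V := Σ i : Fin (2 * n - 1), (A i : Finset α)
  let c : V → Fin (2 * n - 1) := fun v => v.1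
  let e : V → α := fun v => v.2.1
  have he : ∀ v, e v ∈ A (c v) := fun v => v.2.2
  let copy : Fin (2 * n - 1) → Finset V := fun i => Finset.univ.map ⟨Sigma.mk i, sigma_mk_injective⟩
  have hcopy : ∀ i, (copy i).card = (A i).card := fun i => by simp [copy]
  have hcc : ∀ i, ∀ v ∈ copy i, c v = i := by
    intro i v hv
    obtain ⟨a, -, rfl⟩ := Finset.mem_map.1 hv
    rfl
  have hinj : ∀ i, Set.InjOn e (copy i : Set V) := by
    intro i v hv v' hv' h
    obtain ⟨a, -, rfl⟩ := Finset.mem_map.1 hv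
    obtain ⟨a', -, rfl⟩ := Finset.mem_map.1 hv'
    have : a = a' := Subtype.ext h
    rw [this]
  have hind : ∀ (L : Matroid α), (∀ i, L.Indep (A i : Set α)) → ∀ i,
      (L.comap e).Indep (copy i : Set V) := by
    intro L hL i
    rw [Matroid.comap_indep_iff]
    refine ⟨(hL i).subset ?_, hinj i⟩
    rintro _ ⟨v, hv, rfl⟩
    have := he v
    rwa [hcc i v hv] at this
  obtain ⟨P, hPsub, hPn⟩ : ∃ P ⊆ copy ⟨n - 1, by omega⟩, P.card = n := by
    apply Finset.exists_subset_card_eq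
    rw [hcopy]
    have := hcard ⟨n - 1, by omega⟩
    simp only at this
    omega
  obtain ⟨B, hBn, hBM, hBN, hBc⟩ := rbMain c (M.comap e) (N.comap e) n P
    ((hind M hM _).subset (by exact_mod_cast hPsub)) hPn (by
      intro S m hm hS r hr1 hr2
      have hsub : Finset.Ici (⟨m + r - 1, by omega⟩ : Fin (2 * n - 1)) ⊆
          Finset.univ.filter fun k => r ≤ rbRk c (N.comap e) S k := by
        intro i hi
        rw [Finset.mem_Ici, Fin.le_def] at hi
        simp only at hi
        simp only [Finset.mem_filter, Finset.mem_univ, true_and]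
        have h1 := hS (copy i \ S) Finset.sdiff_disjoint
          ((hind M hM i).subset (by exact_mod_cast Finset.sdiff_subset))
        have h2 := le_rbRk c (N.comap e) S i (copy i ∩ S) Finset.inter_subset_right
          (fun v hv => hcc i v (Finset.mem_inter.1 hv).1)
          ((hind N hN i).subset (by exact_mod_cast Finset.inter_subset_left))
        have h3 := Finset.card_sdiff_add_card_inter (copy i) S
        have h4 := hcard i
        rw [hcopy] at h3
        omega
      have h5 := Finset.card_le_card hsub
      rw [Fin.card_Ici] at h5
      simp only at h5
      have h6 : 2 * n - 1 - (m + r - 1) + r ≥ 2 * (n - m) := by omega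
      refine le_trans h6 (Nat.add_le_add_right ?_ r)
      convert h5)
  rw [Matroid.comap_indep_iff] at hBM hBN
  have hs : (B.image c).card = n := by
    rw [Finset.card_image_of_injOn hBc, hBn]
  have hex : ∀ j : Fin n, ∃ v ∈ B, c v = (B.image c).orderEmbOfFin hs j := by
    intro j
    exact Finset.mem_image.1 (Finset.orderEmbOfFin_mem _ hs j)
  choose y hy1 hy2 using hex
  have hr : Set.range (fun j => e (y j)) ⊆ e '' (B : Set V) := by
    rintro _ ⟨j, rfl⟩
    exact ⟨y j, hy1 j, rfl⟩
  refine ⟨(B.image c).orderEmbOfFin hs, fun j => e (y j), OrderEmbedding.strictMono _, ?_, ?_,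
    hBM.1.subset hr, hBN.1.subset hr⟩
  · intro j j' h
    have h1 := hBM.2 (hy1 j) (hy1 j') h
    apply ((B.image c).orderEmbOfFin hs).injective
    rw [← hy2, ← hy2, h1]
  · intro j
    rw [← hy2]
    exact he _
end

section
/- Let M_1, …, M_{2n-1} be matchings in a bipartite graph G satisfying |M_i| ≥ min(i, n) for all i. Then there exists a partial rainbow matching of size n. -/
/-- `M` is a matching of `G`: a set of edges of `G` that are pairwise vertex-disjoint. -/
def IsGraphMatching {α : Type*} (G : SimpleGraph α) (M : Finset (Sym2 α)) : Prop :=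
  (∀ e ∈ M, e ∈ G.edgeSet) ∧
    ∀ e ∈ M, ∀ f ∈ M, e ≠ f → ∀ v : α, v ∈ e → v ∉ f


namespace RB
open Finset
open scoped Classical

/-- Mod 2 chains. -/
abbrev Ch (W : Type*) := Finset W →₀ ZMod 2

noncomputable def ext {W V : Type*} (f : Finset W → Ch V) : Ch W →ₗ[ZMod 2] Ch V :=
  Finsupp.linearCombination (ZMod 2) f

noncomputable def sg {W : Type*} (s : Finset W) : Ch W := Finsupp.single s 1

lemma ext_sg {W V : Type*} (f : Finset W → Ch V) (s : Finset W) : ext f (sg s) = f s := by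
  simp [ext, sg]

lemma hom_eq {W V : Type*} [AddCommGroup V] [Module (ZMod 2) V] {f g : Ch W →ₗ[ZMod 2] V}
    (h : ∀ s, f (sg s) = g (sg s)) (z : Ch W) : f z = g z := by
  have : f = g := by
    apply Finsupp.lhom_ext'
    intro s
    apply LinearMap.ext_ring
    simpa [sg] using h s
  rw [this]

noncomputable def bd {W : Type*} : Ch W →ₗ[ZMod 2] Ch W :=
  ext fun s => ∑ v ∈ s, sg (s.erase v)

noncomputable def cone {W : Type*} (x : W) : Ch W →ₗ[ZMod 2] Ch W :=
  ext fun s => if x ∈ s then 0 else sg (insert x s)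

noncomputable def lk {W : Type*} (x : W) : Ch W →ₗ[ZMod 2] Ch W :=
  ext fun s => if x ∈ s then sg (s.erase x) else 0

lemma bd_sg {W : Type*} (s : Finset W) : bd (sg s) = ∑ v ∈ s, sg (s.erase v) := ext_sg _ _
lemma cone_sg {W : Type*} (x : W) (s : Finset W) :
    cone x (sg s) = if x ∈ s then 0 else sg (insert x s) := ext_sg _ _
lemma lk_sg {W : Type*} (x : W) (s : Finset W) :
    lk x (sg s) = if x ∈ s then sg (s.erase x) else 0 := ext_sg _ _

lemma dbl {W : Type*} (z : Ch W) : z + z = 0 := ZModModule.add_self z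

lemma cone_id {W : Type*} (x : W) (z : Ch W) : bd (cone x z) + cone x (bd z) = z := by
  refine hom_eq (f := bd ∘ₗ cone x + cone x ∘ₗ bd) (g := LinearMap.id) (fun s => ?_) z
  simp only [LinearMap.add_apply, LinearMap.comp_apply, LinearMap.id_apply, cone_sg, bd_sg, map_sum]
  by_cases hx : x ∈ s
  · simp only [hx, if_true, map_zero, zero_add]
    rw [Finset.sum_eq_single x]
    · simp [hx]
    · intro v hv hvx
      simp [hx, Ne.symm hvx]
    · simp [hx]
  · simp only [hx, if_false, bd_sg]
    rw [Finset.sum_insert hx, Finset.erase_insert hx]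
    have : ∑ v ∈ s, sg ((insert x s).erase v) =
        ∑ v ∈ s, (if x ∈ s.erase v then (0 : Ch W) else sg (insert x (s.erase v))) := by
      apply Finset.sum_congr rfl
      intro v hv
      have hxv : x ≠ v := fun h => hx (h ▸ hv)
      rw [if_neg (by simp [hx]), Finset.erase_insert_of_ne hxv]
    rw [this, add_assoc, dbl, add_zero]

lemma bd_bd {W : Type*} (z : Ch W) : bd (bd z) = 0 := by
  refine hom_eq (f := bd ∘ₗ bd) (g := 0) (fun s => ?_) z
  simp only [LinearMap.comp_apply, LinearMap.zero_apply]
  induction s using Finset.induction_on with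
  | empty => simp [bd_sg]
  | insert x s hx ih =>
    have h1 : sg (insert x s) = cone x (sg s) := by simp [cone_sg, hx]
    have h2 : bd (cone x (sg s)) = sg s - cone x (bd (sg s)) := eq_sub_of_add_eq (cone_id x _)
    have h3 : bd (cone x (bd (sg s))) = bd (sg s) := by
      have := cone_id x (bd (sg s))
      rwa [ih, map_zero, add_zero] at this
    rw [h1, h2, map_sub, h3, sub_self]

lemma bd_lk {W : Type*} (x : W) (z : Ch W) : bd (lk x z) = lk x (bd z) := by
  refine hom_eq (f := bd ∘ₗ lk x) (g := lk x ∘ₗ bd) (fun s => ?_) z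
  simp only [LinearMap.comp_apply, lk_sg, bd_sg, map_sum]
  by_cases hx : x ∈ s
  · simp only [hx, if_true, bd_sg]
    rw [← Finset.add_sum_erase s _ hx]
    simp only [Finset.notMem_erase, if_false, zero_add]
    apply Finset.sum_congr rfl
    intro v hv
    rw [if_pos (by simp [hx]; exact (Finset.ne_of_mem_erase hv).symm), Finset.erase_right_comm]
  · simp [hx]

abbrev Sup {W : Type*} (K : Set (Finset W)) : Submodule (ZMod 2) (Ch W) :=
  Finsupp.supported (ZMod 2) (ZMod 2) K

lemma sg_mem {W : Type*} {K : Set (Finset W)} {s : Finset W} (h : s ∈ K) : sg s ∈ Sup K :=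
  Finsupp.single_mem_supported _ _ h

lemma map_mem {W V : Type*} [AddCommGroup V] [Module (ZMod 2) V] {K : Set (Finset W)}
    {L : Submodule (ZMod 2) V}
    (f : Ch W →ₗ[ZMod 2] V) (h : ∀ s ∈ K, f (sg s) ∈ L) {z : Ch W} (hz : z ∈ Sup K) :
    f z ∈ L := by
  have : Sup K ≤ L.comap f := by
    rw [Sup, Finsupp.supported_eq_span_single, Submodule.span_le]
    rintro _ ⟨s, hs, rfl⟩
    exact h s hs
  exact this hz

def Indep {W : Type*} (adj : W → W → Prop) (s : Finset W) : Prop :=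
  ∀ x ∈ s, ∀ y ∈ s, x ≠ y → ¬ adj x y

def KK {W : Type*} (adj : W → W → Prop) (S : Finset W) (j : ℕ) : Set (Finset W) :=
  {s | s ⊆ S ∧ Indep adj s ∧ s.card = j}

def PP {W : Type*} (adj : W → W → Prop) (S : Finset W) (k : ℕ) : Prop :=
  ∀ j < k, ∀ z ∈ Sup (KK adj S j), bd z = 0 → ∃ w ∈ Sup (KK adj S (j+1)), bd w = z

lemma PP.mono {W : Type*} {adj : W → W → Prop} {S : Finset W} {k l : ℕ} (h : PP adj S k)
    (hl : l ≤ k) : PP adj S l := fun j hj => h j (lt_of_lt_of_le hj hl)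

lemma Indep.insert {W : Type*} {adj : W → W → Prop} (hs : ∀ x y, adj x y → adj y x)
    {s : Finset W} {y : W}
    (h : Indep adj s) (hy : ∀ w ∈ s, ¬ adj w y) : Indep adj (insert y s) := by
  intro a ha b hb hab hadj
  rw [Finset.mem_insert] at ha hb
  rcases ha with rfl | ha <;> rcases hb with rfl | hb
  · exact hab rfl
  · exact hy b hb (hs _ _ hadj)
  · exact hy a ha hadj
  · exact h a ha b hb hab hadj

lemma PP_isolated {W : Type*} {adj : W → W → Prop} (hs : ∀ x y, adj x y → adj y x)
    {S : Finset W} {x : W} (hx : x ∈ S)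
    (hiso : ∀ w ∈ S, w ≠ x → ¬ adj w x) (k : ℕ) : PP adj S k := by
  intro j _ z hz hbz
  refine ⟨cone x z, map_mem _ ?_ hz, ?_⟩
  · rintro s ⟨h1, h2, h3⟩
    rw [cone_sg]
    split_ifs with hxs
    · exact Submodule.zero_mem _
    · refine sg_mem ⟨Finset.insert_subset hx h1, h2.insert hs ?_, ?_⟩
      · intro w hw
        exact hiso w (h1 hw) (fun h => hxs (h ▸ hw))
      · rw [Finset.card_insert_of_notMem hxs, h3]
  · have := cone_id x z
    rwa [hbz, map_zero, add_zero] at this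

noncomputable def lkS {W : Type*} (adj : W → W → Prop) (S : Finset W) (y : W) : Finset W :=
  S.filter fun w => w ≠ y ∧ ¬ adj w y

lemma PP_step {W : Type*} {adj : W → W → Prop} (hs : ∀ x y, adj x y → adj y x)
    {S : Finset W} {y : W} {k : ℕ}
    (h1 : PP adj (S.erase y) (k+1)) (h2 : PP adj (lkS adj S y) k) : PP adj S (k+1) := by
  by_cases hy : y ∈ S
  swap
  · rwa [Finset.erase_eq_of_notMem hy] at h1
  have hsub : S.erase y ⊆ S := Finset.erase_subset _ _
  have up : ∀ j, Sup (KK adj (S.erase y) j) ≤ Sup (KK adj S j) := by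
    intro j
    apply Finsupp.supported_mono
    rintro s ⟨a, b, c⟩
    exact ⟨a.trans hsub, b, c⟩
  intro j hj z hz hbz
  -- the link part
  have key : ∃ t, t ∈ Sup (KK adj (lkS adj S y) j) ∧ bd t = lk y z := by
    cases j with
    | zero =>
      refine ⟨0, Submodule.zero_mem _, ?_⟩
      have : lk y z ∈ (⊥ : Submodule (ZMod 2) (Ch W)) := by
        refine map_mem (K := KK adj S 0) _ ?_ hz
        rintro s ⟨_, _, c⟩
        rw [Finset.card_eq_zero] at c
        subst c
        simp [lk_sg]
      rw [map_zero]
      exact ((Submodule.mem_bot _).1 this).symm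
    | succ j =>
      refine (h2 j (by omega) (lk y z) ?_ ?_)
      · refine map_mem _ ?_ hz
        rintro s ⟨a, b, c⟩
        rw [lk_sg]
        split_ifs with hys
        · refine sg_mem ⟨?_, ?_, ?_⟩
          · intro w hw
            have hw1 := Finset.mem_of_mem_erase hw
            have hw2 := Finset.ne_of_mem_erase hw
            exact Finset.mem_filter.2 ⟨a hw1, hw2, b w hw1 y hys hw2⟩
          · intro p hp q hq
            exact b p (Finset.mem_of_mem_erase hp) q (Finset.mem_of_mem_erase hq)
          · rw [Finset.card_erase_of_mem hys, c]; rfl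
        · exact Submodule.zero_mem _
      · rw [bd_lk, hbz, map_zero]
  obtain ⟨t, ht, hbt⟩ := key
  have hbc : bd (cone y t) = t - cone y (lk y z) := by
    rw [← hbt]; exact eq_sub_of_add_eq (cone_id y t)
  have htE : t ∈ Sup (KK adj (S.erase y) j) := by
    refine Finsupp.supported_mono ?_ ht
    rintro s ⟨a, b, c⟩
    refine ⟨fun w hw => ?_, b, c⟩
    have := Finset.mem_filter.1 (a hw)
    exact Finset.mem_erase.2 ⟨this.2.1, this.1⟩
  have hdel : z + cone y (lk y z) ∈ Sup (KK adj (S.erase y) j) := by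
    refine map_mem (LinearMap.id + cone y ∘ₗ lk y) ?_ hz
    rintro s ⟨a, b, c⟩
    simp only [LinearMap.add_apply, LinearMap.comp_apply, LinearMap.id_apply, lk_sg]
    by_cases hys : y ∈ s
    · simp only [hys, if_true, cone_sg, Finset.notMem_erase, if_false, Finset.insert_erase hys, dbl]
      exact Submodule.zero_mem _
    · simp only [hys, if_false, map_zero, add_zero]
      exact sg_mem ⟨fun w hw => Finset.mem_erase.2 ⟨fun h => hys (h ▸ hw), a hw⟩, b, c⟩
  obtain ⟨w, hw, hbw⟩ := h1 j hj (z - bd (cone y t)) (by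
      have : z - bd (cone y t) = (z + cone y (lk y z)) - t := by rw [hbc]; abel
      rw [this]
      exact Submodule.sub_mem _ hdel htE) (by rw [map_sub, bd_bd, hbz, sub_zero])
  refine ⟨w + cone y t, Submodule.add_mem _ (up _ hw) (map_mem _ ?_ ht), ?_⟩
  · rintro s ⟨a, b, c⟩
    have hys : y ∉ s := fun h => (Finset.mem_filter.1 (a h)).2.1 rfl
    rw [cone_sg, if_neg hys]
    refine sg_mem ⟨Finset.insert_subset hy (a.trans (Finset.filter_subset _ _)), b.insert hs ?_, ?_⟩
    · intro v hv
      exact (Finset.mem_filter.1 (a hv)).2.2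
    · rw [Finset.card_insert_of_notMem hys, c]
  · rw [map_add, hbw, sub_add_cancel]

/-- Remove a set `Y` of elements one at a time. -/
lemma PP_remove {W : Type*} {adj : W → W → Prop} (hs : ∀ x y, adj x y → adj y x)
    {S : Finset W} {k : ℕ} (Y : Finset W)
    (h1 : PP adj (S \ Y) (k+1)) (h2 : ∀ y ∈ Y, ∀ Z ⊆ Y, PP adj (lkS adj (S \ Z) y) k) :
    PP adj S (k+1) := by
  induction Y using Finset.induction_on with
  | empty => simpa using h1
  | insert y Y hy ih =>
    apply ih
    · apply PP_step hs (y := y)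
      · rwa [Finset.sdiff_insert] at h1
      · exact h2 y (Finset.mem_insert_self _ _) Y (Finset.subset_insert _ _)
    · intro v hv Z hZ
      exact h2 v (Finset.mem_insert_of_mem hv) Z (hZ.trans (Finset.subset_insert _ _))

/-- Adding a disjoint clique. -/
lemma PP_clique {W : Type*} {adj : W → W → Prop} (hs : ∀ x y, adj x y → adj y x)
    {S T : Finset W} {k : ℕ} (hT : T.Nonempty) (hTT : ∀ x ∈ T, ∀ y ∈ T, adj x y)
    (hTS : ∀ x ∈ S, ∀ y ∈ T, ¬ adj x y) (h : PP adj S k) : PP adj (S ∪ T) (k+1) := by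
  obtain ⟨x, hx⟩ := hT
  have hdis : ∀ x ∈ S, x ∉ T := fun x hx hxT => hTS x hx x hxT (hTT x hxT x hxT)
  apply PP_remove hs (T.erase x)
  · apply PP_isolated hs (x := x)
    · simp [hx]
    · intro w hw hwx
      simp only [Finset.mem_sdiff, Finset.mem_union, Finset.mem_erase] at hw
      rcases hw.1 with h | h
      · exact hTS w h x hx
      · exact absurd ⟨hwx, h⟩ hw.2
  · intro y hy Z hZ
    have hyT := Finset.mem_of_mem_erase hy
    convert h using 1
    ext w
    simp only [lkS, Finset.mem_filter, Finset.mem_sdiff, Finset.mem_union]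
    constructor
    · rintro ⟨⟨h | h, _⟩, _, h2⟩
      · exact h
      · exact absurd (hTT w h y hyT) h2
    · intro hw
      refine ⟨⟨Or.inl hw, fun hz => hdis w hw (Finset.mem_of_mem_erase (hZ hz))⟩, ?_, hTS w hw y hyT⟩
      rintro rfl
      exact hdis _ hw hyT

lemma chains_exist {W A : Type*} {adj : W → W → Prop} (col : W → A) (S : Finset W) (X : Finset A)
    (h : ∀ I ⊆ X, PP adj (S.filter (fun w => col w ∈ I)) I.card) (m : ℕ) :
    ∃ c : Finset A → Ch W, c ∅ = sg ∅ ∧ ∀ I ⊆ X, I.card ≤ m →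
      c I ∈ Sup (KK adj (S.filter (fun w => col w ∈ I)) I.card) ∧
      bd (c I) = ∑ a ∈ I, c (I.erase a) := by
  induction m with
  | zero =>
    refine ⟨fun _ => sg ∅, rfl, ?_⟩
    intro I _ hc
    have : I = ∅ := Finset.card_eq_zero.1 (by omega)
    subst this
    refine ⟨sg_mem ⟨by simp, ?_, by simp⟩, by simp [bd_sg]⟩
    intro x hx
    simp at hx
  | succ m ih =>
    obtain ⟨c, h0, hc⟩ := ih
    have step : ∀ I, ∃ w : Ch W, I ⊆ X → I.card = m + 1 →
        w ∈ Sup (KK adj (S.filter (fun w => col w ∈ I)) (m+1)) ∧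
        bd w = ∑ a ∈ I, c (I.erase a) := by
      intro I
      by_cases hI : I ⊆ X ∧ I.card = m + 1
      swap
      · exact ⟨0, fun a b => absurd ⟨a, b⟩ hI⟩
      obtain ⟨hIX, hIm⟩ := hI
      have hcard : ∀ a ∈ I, (I.erase a).card = m := by
        intro a ha
        rw [Finset.card_erase_of_mem ha, hIm]; rfl
      have hcI : ∀ a ∈ I, _ := fun a ha =>
        hc (I.erase a) ((Finset.erase_subset _ _).trans hIX) (hcard a ha).le
      obtain ⟨w, hw, hbw⟩ := h I hIX m (by omega) (∑ a ∈ I, c (I.erase a)) (by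
        apply Submodule.sum_mem
        intro a ha
        refine Finsupp.supported_mono ?_ (hcI a ha).1
        rintro s ⟨p, q, r⟩
        refine ⟨fun w hw => ?_, q, r.trans (hcard a ha)⟩
        have := Finset.mem_filter.1 (p hw)
        exact Finset.mem_filter.2 ⟨this.1, Finset.mem_of_mem_erase this.2⟩) (by
        have e1 : bd (∑ a ∈ I, c (I.erase a)) = ext c (bd (bd (sg I))) := by
          rw [bd_sg, map_sum, map_sum, map_sum]
          apply Finset.sum_congr rfl
          intro a ha
          rw [(hcI a ha).2, bd_sg, map_sum]
          exact Finset.sum_congr rfl (fun b _ => (ext_sg _ _).symm)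
        rw [e1, bd_bd, map_zero])
      exact ⟨w, fun _ _ => ⟨hw, hbw⟩⟩
    choose w hw using step
    refine ⟨fun I => if I.card = m + 1 then w I else c I, by simp [h0], ?_⟩
    intro I hIX hIm
    by_cases hI : I.card = m + 1
    · simp only [hI, if_true]
      refine ⟨(hw I hIX hI).1, ?_⟩
      rw [(hw I hIX hI).2]
      apply Finset.sum_congr rfl
      intro a ha
      rw [if_neg]
      rw [Finset.card_erase_of_mem ha]; omega
    · simp only [hI, if_false]
      have := hc I hIX (by omega)
      refine ⟨this.1, ?_⟩
      rw [this.2]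
      apply Finset.sum_congr rfl
      intro a ha
      rw [if_neg]
      rw [Finset.card_erase_of_mem ha]; omega

/-- Parity of the number of rainbow members with colour set `I`. -/
noncomputable def rr {W A : Type*} (col : W → A) (I : Finset A) : Ch W →ₗ[ZMod 2] ZMod 2 :=
  Finsupp.linearCombination (ZMod 2)
    (fun s => if s.image col = I ∧ s.card = I.card then (1 : ZMod 2) else 0)

lemma rr_sg {W A : Type*} (col : W → A) (I : Finset A) (s : Finset W) :
    rr col I (sg s) = if s.image col = I ∧ s.card = I.card then (1 : ZMod 2) else 0 := by
  simp [rr, sg]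

lemma rr_bd_sg {W A : Type*} (col : W → A) (I : Finset A) (a : A) (ha : a ∈ I) (s : Finset W)
    (hs : ∀ w ∈ s, col w ∈ I) (hc : s.card = I.card) :
    rr col (I.erase a) (bd (sg s)) = rr col I (sg s) := by
  rw [bd_sg, map_sum]
  simp only [rr_sg, hc, and_true]
  have hcd : ∀ v ∈ s, (s.erase v).card = (I.erase a).card := by
    intro v hv
    rw [Finset.card_erase_of_mem hv, Finset.card_erase_of_mem ha, hc]
  have e1 : ∑ v ∈ s, (if (s.erase v).image col = I.erase a ∧ (s.erase v).card = (I.erase a).card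
      then (1 : ZMod 2) else 0) =
      ((s.filter (fun v => (s.erase v).image col = I.erase a)).card : ZMod 2) := by
    rw [Finset.card_filter, Nat.cast_sum]
    apply Finset.sum_congr rfl
    intro v hv
    simp [hcd v hv]
  rw [e1]
  by_cases him : s.image col = I
  · rw [if_pos him]
    have hinj : Set.InjOn col s := Finset.card_image_iff.1 (by rw [him, hc])
    obtain ⟨v, hv, hva⟩ : ∃ v ∈ s, col v = a := by
      rw [← him] at ha; simpa using ha
    have : s.filter (fun v => (s.erase v).image col = I.erase a) = {v} := by
      ext u
      simp only [Finset.mem_filter, Finset.mem_singleton]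
      constructor
      · rintro ⟨hu, hue⟩
        by_contra hne
        have : a ∈ (s.erase u).image col :=
          Finset.mem_image.2 ⟨v, Finset.mem_erase.2 ⟨fun h => hne h.symm, hv⟩, hva⟩
        rw [hue] at this
        simp at this
      · rintro rfl
        refine ⟨hv, ?_⟩
        apply Finset.eq_of_subset_of_card_le
        · intro b hb
          obtain ⟨p, hp, rfl⟩ := Finset.mem_image.1 hb
          have hps := Finset.mem_of_mem_erase hp
          refine Finset.mem_erase.2 ⟨fun h => ?_, hs p hps⟩
          exact Finset.ne_of_mem_erase hp (hinj hps hv (h.trans hva.symm))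
        · rw [Finset.card_image_of_injOn (hinj.mono (by simp)), hcd _ hv]
    rw [this]; simp
  · rw [if_neg him]
    by_cases hemp : s.filter (fun v => (s.erase v).image col = I.erase a) = ∅
    · rw [hemp]; simp
    obtain ⟨v, hv⟩ := Finset.nonempty_iff_ne_empty.2 hemp
    rw [Finset.mem_filter] at hv
    obtain ⟨hv, hve⟩ := hv
    have hinj : Set.InjOn col (s.erase v) := Finset.card_image_iff.1 (by rw [hve, hcd v hv])
    have hva : col v ≠ a := by
      intro h
      apply him
      rw [← Finset.insert_erase hv, Finset.image_insert, hve, h, Finset.insert_erase ha]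
    have hvm : col v ∈ (s.erase v).image col := by
      rw [hve]; exact Finset.mem_erase.2 ⟨hva, hs v hv⟩
    obtain ⟨u, hu, huv⟩ := Finset.mem_image.1 hvm
    have hus := Finset.mem_of_mem_erase hu
    have huv' := Finset.ne_of_mem_erase hu
    have : s.filter (fun v => (s.erase v).image col = I.erase a) = {v, u} := by
      ext p
      simp only [Finset.mem_filter, Finset.mem_singleton, Finset.mem_insert]
      constructor
      · rintro ⟨hp, hpe⟩
        by_contra hne
        push Not at hne
        have hpi : Set.InjOn col (s.erase p) := Finset.card_image_iff.1 (by rw [hpe, hcd p hp])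
        have := hpi (Finset.mem_coe.2 (Finset.mem_erase.2 ⟨hne.2.symm, hus⟩))
          (Finset.mem_coe.2 (Finset.mem_erase.2 ⟨hne.1.symm, hv⟩)) huv
        exact huv' this
      · rintro (rfl | rfl)
        · exact ⟨hv, hve⟩
        · refine ⟨hus, ?_⟩
          rw [← hve]
          have e2 : s.erase p = insert v ((s.erase v).erase p) := by
            rw [Finset.erase_right_comm, Finset.insert_erase]
            exact Finset.mem_erase.2 ⟨huv'.symm, hv⟩
          rw [e2, Finset.image_insert, ← huv, ← Finset.image_insert, Finset.insert_erase hu]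
    rw [this, Finset.card_pair huv'.symm]
    rfl

lemma rr_bd {W A : Type*} {adj : W → W → Prop} (col : W → A) (S : Finset W) (I : Finset A)
    (a : A) (ha : a ∈ I) {z : Ch W}
    (hz : z ∈ Sup (KK adj (S.filter (fun w => col w ∈ I)) I.card)) :
    rr col (I.erase a) (bd z) = rr col I z := by
  have : (rr col (I.erase a) ∘ₗ bd - rr col I) z ∈ (⊥ : Submodule (ZMod 2) (ZMod 2)) := by
    refine map_mem _ ?_ hz
    rintro s ⟨p, _, r⟩
    rw [Submodule.mem_bot, LinearMap.sub_apply, LinearMap.comp_apply, sub_eq_zero]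
    exact rr_bd_sg col I a ha s (fun w hw => (Finset.mem_filter.1 (p hw)).2) r
  rw [Submodule.mem_bot, LinearMap.sub_apply, LinearMap.comp_apply, sub_eq_zero] at this
  exact this

lemma hall {W A : Type*} {adj : W → W → Prop} (col : W → A) (S : Finset W) (X : Finset A)
    (h : ∀ I ⊆ X, PP adj (S.filter (fun w => col w ∈ I)) I.card) :
    ∃ F ⊆ S, Indep adj F ∧ F.image col = X ∧ F.card = X.card := by
  obtain ⟨c, h0, hc⟩ := chains_exist col S X h X.card
  have main : ∀ I ⊆ X, rr col I (c I) = 1 := by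
    intro I
    induction I using Finset.induction_on with
    | empty =>
      intro _
      rw [h0, rr_sg]; simp
    | insert a I ha ih =>
      intro hI
      have hX := (Finset.subset_insert a I).trans hI
      have hci := hc (insert a I) hI (Finset.card_le_card hI)
      rw [← rr_bd col S (insert a I) a (Finset.mem_insert_self _ _) hci.1, hci.2, map_sum,
        Finset.erase_insert ha, Finset.sum_insert ha, Finset.erase_insert ha, ih hX]
      rw [Finset.sum_eq_zero, add_zero]
      intro b hb
      have hab : a ≠ b := fun h => ha (h ▸ hb)
      have hsub : (insert a I).erase b ⊆ X := (Finset.erase_subset _ _).trans hI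
      have hcb := (hc _ hsub (Finset.card_le_card hsub)).1
      have : rr col I (c ((insert a I).erase b)) ∈ (⊥ : Submodule (ZMod 2) (ZMod 2)) := by
        refine map_mem _ ?_ hcb
        rintro s ⟨p, _, r⟩
        rw [Submodule.mem_bot, rr_sg, if_neg]
        rintro ⟨h1, _⟩
        rw [← h1] at hb
        obtain ⟨w, hw, hwb⟩ := Finset.mem_image.1 hb
        have := (Finset.mem_filter.1 (p hw)).2
        rw [hwb] at this
        simp at this
      exact (Submodule.mem_bot _).1 this
  have hX := main X subset_rfl
  by_contra hno
  have : rr col X (c X) ∈ (⊥ : Submodule (ZMod 2) (ZMod 2)) := by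
    refine map_mem _ ?_ (hc X subset_rfl le_rfl).1
    rintro s ⟨p, q, r⟩
    rw [Submodule.mem_bot, rr_sg, if_neg]
    rintro ⟨h1, h2⟩
    exact hno ⟨s, p.trans (Finset.filter_subset _ _), q, h1, h2⟩
  rw [Submodule.mem_bot, hX] at this
  exact one_ne_zero this

/-- Elements together with dummies. -/
inductive Dum (W A : Type*) where
  | real (w : W) : Dum W A
  | dum (i : ℕ) (a : A) : Dum W A

/-- Conflict relation with dummies. -/
def dadj {W A : Type*} (adj : W → W → Prop) : Dum W A → Dum W A → Prop
  | .real x, .real y => adj x y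
  | .dum i _, .dum j _ => i = j
  | _, _ => False

def dfun {W A T : Type*} (f : W → T) (g : A → T) : Dum W A → T
  | .real x => f x
  | .dum _ a => g a

def didx {W A : Type*} : Dum W A → ℕ
  | .real _ => 0
  | .dum i _ => i

lemma dadj_symm {W A : Type*} {adj : W → W → Prop} (hs : ∀ x y, adj x y → adj y x) :
    ∀ x y, dadj (A := A) adj x y → dadj adj y x := by
  rintro (x | ⟨i, x⟩) (y | ⟨j, y⟩) h
  · exact hs _ _ h
  · exact h
  · exact h
  · exact Eq.symm h

noncomputable def dset {W A : Type*} (m : ℕ) (I : Finset A) : Finset (Dum W A) :=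
  (range m).biUnion fun i => I.image (Dum.dum i)

lemma real_mem_dset {W A : Type*} (m : ℕ) (I : Finset A) (w : W) :
    Dum.real w ∉ dset m I := by simp [dset]

lemma dum_mem_dset {W A : Type*} (m : ℕ) (I : Finset A) (i : ℕ) (a : A) :
    (Dum.dum i a : Dum W A) ∈ dset m I ↔ i < m ∧ a ∈ I := by simp [dset]

lemma real_mem {W A : Type*} (S : Finset W) (w : W) :
    (Dum.real w : Dum W A) ∈ S.image Dum.real ↔ w ∈ S := by simp

lemma dum_mem {W A : Type*} (S : Finset W) (i : ℕ) (a : A) :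
    (Dum.dum i a : Dum W A) ∉ S.image Dum.real := by simp

lemma real_inj {W A : Type*} : Function.Injective (Dum.real : W → Dum W A) := by
  intro x y h
  injection h

lemma hall_def {W A : Type*} {adj : W → W → Prop} (hs : ∀ x y, adj x y → adj y x)
    (col : W → A) (S : Finset W) (X : Finset A) (d : ℕ)
    (h : ∀ I ⊆ X, PP (dadj (A := A) adj)
      ((S.filter (fun w => col w ∈ I)).image Dum.real) (I.card - d)) :
    ∃ F ⊆ S, Indep adj F ∧ Set.InjOn col F ∧ X.card ≤ F.card + d := by
  have hH : ∀ I ⊆ X, I.Nonempty → ∀ m, PP (dadj (A := A) adj)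
      ((S.filter (fun w => col w ∈ I)).image Dum.real ∪ dset m I) (I.card - d + m) := by
    intro I hI hne m
    induction m with
    | zero => simpa [dset] using h I hI
    | succ m ih =>
      have e : (S.filter (fun w => col w ∈ I)).image Dum.real ∪ dset (m+1) I
        = ((S.filter (fun w => col w ∈ I)).image Dum.real ∪ dset m I) ∪ I.image (Dum.dum m) := by
        rw [Finset.union_assoc]
        congr 1
        rw [dset, Finset.range_add_one, Finset.biUnion_insert, Finset.union_comm]
        rfl
      rw [e, ← add_assoc]
      refine PP_clique (dadj_symm hs) (hne.image _) ?_ ?_ ih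
      · intro x hx y hy
        obtain ⟨p, hp, rfl⟩ := Finset.mem_image.1 hx
        obtain ⟨q, hq, rfl⟩ := Finset.mem_image.1 hy
        exact rfl
      · intro x hx y hy
        obtain ⟨q, hq, rfl⟩ := Finset.mem_image.1 hy
        rcases x with x | ⟨i, x⟩
        · exact fun h => h
        · rcases Finset.mem_union.1 hx with hx | hx
          · exact absurd hx (dum_mem _ _ _)
          · have := ((dum_mem_dset _ _ _ _).1 hx).1
            show ¬ (i = m)
            omega
  obtain ⟨F, hFS, hFi, hFX, hFc⟩ := hall (adj := dadj (A := A) adj) (dfun col id)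
    (S.image Dum.real ∪ dset d X) X (by
      intro I hI
      rcases Finset.eq_empty_or_nonempty I with rfl | hne
      · intro j hj
        simp at hj
      refine PP.mono ?_ (show I.card ≤ I.card - d + d by omega)
      convert hH I hI hne d using 1
      ext w
      rw [Finset.mem_filter]
      rcases w with w | ⟨i, w⟩
      · simp only [Finset.mem_filter, Finset.mem_union, real_mem, real_mem_dset, or_false, dfun]
      · simp only [Finset.mem_filter, Finset.mem_union, dum_mem, dum_mem_dset, false_or, dfun, id]
        constructor
        · rintro ⟨h1, h2⟩
          exact ⟨h1.1, h2⟩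
        · rintro ⟨h1, h2⟩
          exact ⟨⟨h1, hI h2⟩, h2⟩)
  have hinj : Set.InjOn (dfun col id) F := Finset.card_image_iff.1 (by rw [hFX, hFc])
  have hmem : ∀ w, w ∈ S.filter (fun w => Dum.real w ∈ F) ↔ Dum.real w ∈ F := by
    intro w
    rw [Finset.mem_filter]
    refine ⟨fun h => h.2, fun h => ⟨?_, h⟩⟩
    rcases Finset.mem_union.1 (hFS h) with h' | h'
    · exact (real_mem _ _).1 h'
    · exact absurd h' (real_mem_dset _ _ _)
  refine ⟨S.filter (fun w => Dum.real w ∈ F), Finset.filter_subset _ _, ?_, ?_, ?_⟩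
  · intro x hx y hy hxy
    exact hFi _ ((hmem x).1 hx) _ ((hmem y).1 hy) (fun h => hxy (real_inj h))
  · intro x hx y hy hxy
    exact real_inj (hinj ((hmem x).1 hx) ((hmem y).1 hy) hxy)
  · rw [← hFc]
    have hsub : F ⊆ (S.filter (fun w => Dum.real w ∈ F)).image Dum.real ∪
        F.filter (fun x => ∃ i a, x = Dum.dum i a) := by
      intro x hx
      rcases x with x | ⟨i, x⟩
      · exact Finset.mem_union_left _ ((real_mem _ _).2 ((hmem x).2 hx))
      · exact Finset.mem_union_right _ (Finset.mem_filter.2 ⟨hx, i, x, rfl⟩)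
    have h1 := (Finset.card_le_card hsub).trans (Finset.card_union_le _ _)
    rw [Finset.card_image_of_injective _ real_inj] at h1
    have h2 : (F.filter (fun x => ∃ i a, x = Dum.dum i a)).card ≤ (range d).card := by
      apply Finset.card_le_card_of_injOn didx
      · intro x hx
        obtain ⟨hx, i, a, rfl⟩ := Finset.mem_filter.1 (Finset.mem_coe.1 hx)
        rcases Finset.mem_union.1 (hFS hx) with h' | h'
        · exact absurd h' (dum_mem _ _ _)
        · exact Finset.mem_coe.2 (Finset.mem_range.2 ((dum_mem_dset _ _ _ _).1 h').1)
      · intro x hx y hy hxy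
        obtain ⟨hx, i, a, rfl⟩ := Finset.mem_filter.1 (Finset.mem_coe.1 hx)
        obtain ⟨hy, j, b, rfl⟩ := Finset.mem_filter.1 (Finset.mem_coe.1 hy)
        by_contra hne
        exact hFi _ hx _ hy hne hxy
    rw [Finset.card_range] at h2
    omega

noncomputable def DD {W C : Type*} (c : W → C) (S : Finset W) (t : ℕ) : Finset C :=
  (S.image c).filter fun i => t ≤ (S.filter fun w => c w = i).card

lemma game {W B C : Type*} {adj : W → W → Prop} (hs : ∀ x y, adj x y → adj y x)
    (b : W → B) (c : W → C) (n : ℕ) : ∀ S : Finset W,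
    (∀ x ∈ S, ∀ y ∈ S, x ≠ y → (adj x y ↔ (b x = b y ∨ c x = c y))) →
    (∀ x ∈ S, ∀ y ∈ S, b x = b y → c x = c y → x = y) →
    (∀ t, 1 ≤ t → t ≤ n → 2 * n ≤ t + (DD c S t).card) → PP adj S n := by
  induction n with
  | zero => intro S _ _ _ j hj; omega
  | succ n ih =>
    intro S hadj huniq hdeg
    have hD1 := hdeg 1 le_rfl (by omega)
    have hne : (S.image c).Nonempty := by
      rw [Finset.nonempty_iff_ne_empty]
      intro h0
      simp [DD, h0] at hD1
      omega
    obtain ⟨c0, hc0, hmin⟩ := Finset.exists_min_image (S.image c)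
      (fun i => (S.filter fun w => c w = i).card) hne
    obtain ⟨x, hx, hxc⟩ := Finset.mem_image.1 hc0
    have key : ∀ S' ⊆ S, ∀ y ∈ S, (∀ w ∈ S, c w ≠ c0 → c w ≠ c y → b w ≠ b y → w ∈ S') →
        PP adj S' n := by
      intro S' hS' y hy hw
      apply ih S' (fun p hp q hq => hadj p (hS' hp) q (hS' hq))
        (fun p hp q hq => huniq p (hS' hp) q (hS' hq))
      intro t ht1 htn
      have hsub : ((DD c S (t+1)).erase c0).erase (c y) ⊆ DD c S' t := by
        intro i hi
        simp only [Finset.mem_erase, DD, Finset.mem_filter] at hi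
        obtain ⟨hiy, hi0, hiS, hit⟩ := hi
        have h1 : ((S.filter fun w => c w = i) \ (S'.filter fun w => c w = i)).card ≤ 1 := by
          rw [Finset.card_le_one]
          have hb : ∀ p ∈ (S.filter fun w => c w = i) \ (S'.filter fun w => c w = i),
              p ∈ S ∧ c p = i ∧ b p = b y := by
            intro p hp
            simp only [Finset.mem_sdiff, Finset.mem_filter] at hp
            refine ⟨hp.1.1, hp.1.2, ?_⟩
            by_contra hne
            exact hp.2 ⟨hw p hp.1.1 (by rw [hp.1.2]; exact hi0) (by rw [hp.1.2]; exact hiy) hne,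
              hp.1.2⟩
          intro p hp q hq
          obtain ⟨p1, p2, p3⟩ := hb p hp
          obtain ⟨q1, q2, q3⟩ := hb q hq
          exact huniq p p1 q q1 (p3.trans q3.symm) (p2.trans q2.symm)
        have h2 := Finset.le_card_sdiff (S'.filter fun w => c w = i) (S.filter fun w => c w = i)
        have h3 : t ≤ (S'.filter fun w => c w = i).card := by omega
        refine Finset.mem_filter.2 ⟨?_, h3⟩
        obtain ⟨w, hw⟩ := Finset.card_pos.1 (lt_of_lt_of_le ht1 h3)
        rw [Finset.mem_filter] at hw
        exact Finset.mem_image.2 ⟨w, hw⟩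
      have hle := Finset.card_le_card hsub
      have e1 := Finset.pred_card_le_card_erase (s := (DD c S (t+1)).erase c0) (a := c y)
      by_cases h0 : c0 ∈ DD c S (t+1)
      · have hsub2 : DD c S 1 ⊆ DD c S (t+1) := by
          intro i hi
          have hi := (Finset.mem_filter.1 hi).1
          exact Finset.mem_filter.2 ⟨hi, (Finset.mem_filter.1 h0).2.trans (hmin i hi)⟩
        have hle2 := Finset.card_le_card hsub2
        have e2 := Finset.pred_card_le_card_erase (s := DD c S (t+1)) (a := c0)
        omega
      · rw [Finset.erase_eq_of_notMem h0] at e1 hle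
        have := hdeg (t+1) (by omega) (by omega)
        omega
    apply PP_remove hs (S.filter fun w => c w = c0 ∧ w ≠ x)
    · set S1 := S \ (S.filter fun w => c w = c0 ∧ w ≠ x) with hS1
      have hS1S : S1 ⊆ S := Finset.sdiff_subset
      have hS1c : ∀ w ∈ S1, w ≠ x → c w ≠ c0 := by
        intro w hw hwx hwc
        exact (Finset.mem_sdiff.1 hw).2 (Finset.mem_filter.2 ⟨hS1S hw, hwc, hwx⟩)
      have hY : ∀ w ∈ S1.filter (fun w => adj w x ∧ w ≠ x), w ∈ S ∧ b w = b x := by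
        intro w hw
        obtain ⟨hw, hwa, hwx⟩ := Finset.mem_filter.1 hw
        refine ⟨hS1S hw, ?_⟩
        rcases (hadj w (hS1S hw) x hx hwx).1 hwa with h | h
        · exact h
        · exact absurd (h.trans hxc) (hS1c w hw hwx)
      apply PP_remove hs (S1.filter fun w => adj w x ∧ w ≠ x)
      · apply PP_isolated hs (x := x)
        · simp [hS1, hx]
        · intro w hw hwx hwa
          rw [Finset.mem_sdiff] at hw
          exact hw.2 (Finset.mem_filter.2 ⟨hw.1, hwa, hwx⟩)
      · intro y hy Z hZ
        obtain ⟨hyS, hyb⟩ := hY y hy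
        refine key _ ?_ y hyS ?_
        · exact (Finset.filter_subset _ _).trans (Finset.sdiff_subset.trans hS1S)
        · intro w hw hw0 hwc hwb
          have hwy : w ≠ y := fun h => hwc (by rw [h])
          refine Finset.mem_filter.2 ⟨Finset.mem_sdiff.2 ⟨Finset.mem_sdiff.2 ⟨hw, ?_⟩, ?_⟩, hwy, ?_⟩
          · intro h
            exact hw0 (Finset.mem_filter.1 h).2.1
          · intro h
            exact hwb ((hY w (hZ h)).2.trans hyb.symm)
          · rw [hadj w hw y hyS hwy]
            tauto
    · intro y hy Z hZ
      have hyS := (Finset.mem_filter.1 hy).1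
      refine key _ ?_ y hyS ?_
      · exact (Finset.filter_subset _ _).trans Finset.sdiff_subset
      · intro w hw hw0 hwc hwb
        have hwy : w ≠ y := fun h => hwc (by rw [h])
        refine Finset.mem_filter.2 ⟨Finset.mem_sdiff.2 ⟨hw, ?_⟩, hwy, ?_⟩
        · intro h
          exact hw0 (Finset.mem_filter.1 (hZ h)).2.1
        · rw [hadj w hw y hyS hwy]
          tauto

lemma edge_ends {α : Type*} (G : SimpleGraph α) (f : G.Coloring (Fin 2)) (e : Sym2 α)
    (he : e ∈ G.edgeSet) : ∃ p : α × α, e = s(p.1, p.2) ∧ f p.1 = 0 ∧ f p.2 = 1 := by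
  induction e using Sym2.ind with
  | _ x y =>
    have h : f x ≠ f y := f.valid he
    by_cases hx : f x = 0
    · exact ⟨(x, y), rfl, hx, by simp only; omega⟩
    · exact ⟨(y, x), Sym2.eq_swap, by simp only; omega, by simp only; omega⟩

lemma mem_DD {W C : Type*} (c : W → C) (S T : Finset W) (t : ℕ) (i : C) (ht : 1 ≤ t)
    (hTS : T ⊆ S) (hTi : ∀ w ∈ T, c w = i) (hT : t ≤ T.card) : i ∈ DD c S t := by
  refine Finset.mem_filter.2 ⟨?_, hT.trans (Finset.card_le_card fun w hw =>
    Finset.mem_filter.2 ⟨hTS hw, hTi w hw⟩)⟩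
  obtain ⟨w, hw⟩ := Finset.card_pos.1 (lt_of_lt_of_le ht hT)
  exact Finset.mem_image.2 ⟨w, hTS hw, hTi w hw⟩

lemma core {W A B C : Type*} [Nonempty B] [Nonempty C] (a : W → A) (b : W → B) (c : W → C)
    (S : Finset W) (n : ℕ)
    (hua : ∀ x ∈ S, ∀ y ∈ S, a x = a y → c x = c y → x = y)
    (hub : ∀ x ∈ S, ∀ y ∈ S, b x = b y → c x = c y → x = y)
    (hdeg : ∀ t, 1 ≤ t → t ≤ n → 2 * n ≤ t + (DD c S t).card)
    (hn : n ≤ (S.image a).card) :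
    ∃ F ⊆ S, Indep (fun x y => b x = b y ∨ c x = c y) F ∧ Set.InjOn a F ∧ n ≤ F.card := by
  have hsym : ∀ x y : W, (b x = b y ∨ c x = c y) → (b y = b x ∨ c y = c x) :=
    fun x y h => h.imp Eq.symm Eq.symm
  obtain ⟨F, hFS, hFi, hFa, hFc⟩ := hall_def (adj := fun x y => b x = b y ∨ c x = c y) hsym a S
    (S.image a) ((S.image a).card - n) (by
    intro I hI
    have hIX := Finset.card_le_card hI
    apply game (dadj_symm hsym) (dfun b fun _ => Classical.arbitrary B)
      (dfun c fun _ => Classical.arbitrary C)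
    · intro x hx y hy hxy
      obtain ⟨x, _, rfl⟩ := Finset.mem_image.1 hx
      obtain ⟨y, _, rfl⟩ := Finset.mem_image.1 hy
      exact Iff.rfl
    · intro x hx y hy h1 h2
      obtain ⟨x, hx1, rfl⟩ := Finset.mem_image.1 hx
      obtain ⟨y, hy1, rfl⟩ := Finset.mem_image.1 hy
      rw [hub x (Finset.mem_filter.1 hx1).1 y (Finset.mem_filter.1 hy1).1 h1 h2]
    · intro t ht1 htn
      set e := (S.image a).card - I.card with he
      have hsub : DD c S (t + e) ⊆ DD (dfun c fun _ => Classical.arbitrary C)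
          ((S.filter fun w => a w ∈ I).image (Dum.real : W → Dum W A)) t := by
        intro i hi
        have hi := (Finset.mem_filter.1 hi).2
        have h1 : ((S.filter fun w => c w = i).filter fun w => ¬ a w ∈ I).card ≤
            (S.image a \ I).card := by
          apply Finset.card_le_card_of_injOn a
          · intro w hw
            have hw := Finset.mem_filter.1 (Finset.mem_coe.1 hw)
            exact Finset.mem_coe.2 (Finset.mem_sdiff.2
              ⟨Finset.mem_image_of_mem a (Finset.mem_filter.1 hw.1).1, hw.2⟩)
          · intro x hx y hy h
            have hx := Finset.mem_filter.1 (Finset.mem_filter.1 (Finset.mem_coe.1 hx)).1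
            have hy := Finset.mem_filter.1 (Finset.mem_filter.1 (Finset.mem_coe.1 hy)).1
            exact hua x hx.1 y hy.1 h (hx.2.trans hy.2.symm)
        rw [Finset.card_sdiff_of_subset hI, ← he] at h1
        have h2 := Finset.card_filter_add_card_filter_not (s := S.filter fun w => c w = i)
          (fun w => a w ∈ I)
        refine mem_DD _ _ (((S.filter fun w => c w = i).filter fun w => a w ∈ I).image Dum.real)
          t i ht1 ?_ ?_ ?_
        · apply Finset.image_subset_image
          intro w hw
          obtain ⟨hw, hwI⟩ := Finset.mem_filter.1 hw
          exact Finset.mem_filter.2 ⟨(Finset.mem_filter.1 hw).1, hwI⟩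
        · intro w hw
          obtain ⟨w, hw1, rfl⟩ := Finset.mem_image.1 hw
          exact (Finset.mem_filter.1 (Finset.mem_filter.1 hw1).1).2
        · rw [Finset.card_image_of_injective _ real_inj]
          omega
      have h1 := Finset.card_le_card hsub
      have h2 := hdeg (t + e) (by omega) (by omega)
      omega)
  exact ⟨F, hFS, hFi, hFa, by omega⟩

lemma rainbow_set {α : Type*} (G : SimpleGraph α)
    (hbip : G.Colorable 2) (n : ℕ) (hn : 1 ≤ n) (M : Fin (2 * n - 1) → Finset (Sym2 α))
    (hmatch : ∀ i, IsGraphMatching G (M i))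
    (hcard : ∀ i : Fin (2 * n - 1), min (i.1 + 1) n ≤ (M i).card) :
    ∃ F : Finset (Fin (2 * n - 1) × Sym2 α), n ≤ F.card ∧ (∀ w ∈ F, w.2 ∈ M w.1) ∧
      ∀ x ∈ F, ∀ y ∈ F, x ≠ y → x.1 ≠ y.1 ∧ ∀ v, v ∈ x.2 → v ∉ y.2 := by
  obtain ⟨f⟩ := hbip
  have hp : ∀ e : Sym2 α, ∃ p : α × α, e ∈ G.edgeSet → e = s(p.1, p.2) ∧ f p.1 = 0 ∧ f p.2 = 1 := by
    intro e
    by_cases he : e ∈ G.edgeSet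
    · obtain ⟨p, hp⟩ := edge_ends G f e he
      exact ⟨p, fun _ => hp⟩
    · induction e using Sym2.ind with
      | _ x y => exact ⟨(x, y), fun h => absurd h he⟩
  choose p hp using hp
  let a : Fin (2 * n - 1) × Sym2 α → α := fun w => (p w.2).1
  let b : Fin (2 * n - 1) × Sym2 α → α := fun w => (p w.2).2
  let c : Fin (2 * n - 1) × Sym2 α → Fin (2 * n - 1) := fun w => w.1
  let S : Finset (Fin (2 * n - 1) × Sym2 α) :=
    Finset.univ.biUnion fun i => (M i).image (Prod.mk i)
  have hS : ∀ w, w ∈ S ↔ w.2 ∈ M w.1 := by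
    rintro ⟨i, e⟩
    simp [S]
  have hE : ∀ w ∈ S, w.2 = s(a w, b w) ∧ f (a w) = 0 ∧ f (b w) = 1 := by
    intro w hw
    exact hp w.2 ((hmatch w.1).1 _ ((hS w).1 hw))
  have hshare : ∀ x ∈ S, ∀ y ∈ S, c x = c y → ∀ v, v ∈ x.2 → v ∈ y.2 → x = y := by
    rintro ⟨i, e⟩ hx ⟨j, g⟩ hy hc v hv hv'
    have hc : i = j := hc
    subst hc
    by_contra hne
    exact (hmatch i).2 e ((hS _).1 hx) g ((hS _).1 hy) (fun h => hne (by rw [h])) v hv hv'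
  have hub : ∀ x ∈ S, ∀ y ∈ S, b x = b y → c x = c y → x = y := by
    intro x hx y hy hb hc
    apply hshare x hx y hy hc (b x)
    · rw [(hE x hx).1]; simp
    · rw [(hE y hy).1, hb]; simp
  have hua : ∀ x ∈ S, ∀ y ∈ S, a x = a y → c x = c y → x = y := by
    intro x hx y hy hb hc
    apply hshare x hx y hy hc (a x)
    · rw [(hE x hx).1]; simp
    · rw [(hE y hy).1, hb]; simp
  have hTS : ∀ i, (M i).image (Prod.mk i) ⊆ S := by
    intro i w hw
    obtain ⟨e, he, rfl⟩ := Finset.mem_image.1 hw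
    exact (hS _).2 he
  have hTc : ∀ i, ∀ w ∈ (M i).image (Prod.mk i), c w = i := by
    intro i w hw
    obtain ⟨e, he, rfl⟩ := Finset.mem_image.1 hw
    rfl
  have hTcard : ∀ i, ((M i).image (Prod.mk i)).card = (M i).card := by
    intro i
    apply Finset.card_image_of_injective
    intro x y h
    exact (Prod.mk.inj h).2
  let l : Fin (2 * n - 1) := ⟨2 * n - 2, by omega⟩
  have hl : l.1 = 2 * n - 2 := rfl
  have hXn : n ≤ (S.image a).card := by
    have h1 := hcard l
    rw [← hTcard l] at h1
    have h2 : ((M l).image (Prod.mk l)).card ≤ (S.image a).card := by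
      apply Finset.card_le_card_of_injOn a
      · intro w hw
        exact Finset.mem_coe.2 (Finset.mem_image_of_mem a (hTS l (Finset.mem_coe.1 hw)))
      · intro x hx y hy h
        exact hua x (hTS l hx) y (hTS l hy) h ((hTc l x hx).trans (hTc l y hy).symm)
    omega
  have hSne : S.Nonempty := by
    rw [Finset.nonempty_iff_ne_empty]
    intro h0
    rw [h0] at hXn
    simp at hXn
    omega
  have : Nonempty α := ⟨a hSne.choose⟩
  have : Nonempty (Fin (2 * n - 1)) := ⟨l⟩
  obtain ⟨F, hFS, hFi, hFa, hFc⟩ := core a b c S n hua hub (by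
    intro t ht1 htn
    have hsub : (Finset.univ : Finset (Fin (2 * n - 1))).filter
        (fun i => ¬ (i.1 + 1 < t)) ⊆ DD c S t := by
      intro i hi
      have hi := (Finset.mem_filter.1 hi).2
      have h2 := hcard i
      refine mem_DD c S _ t i ht1 (hTS i) (hTc i) ?_
      rw [hTcard]
      omega
    have h1 := Finset.card_le_card hsub
    have h2 := Finset.card_filter_add_card_filter_not
      (s := (Finset.univ : Finset (Fin (2 * n - 1)))) (fun i => i.1 + 1 < t)
    rw [Finset.card_univ, Fintype.card_fin] at h2
    have h3 : ((Finset.univ : Finset (Fin (2 * n - 1))).filter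
        (fun i => i.1 + 1 < t)).card ≤ (range (t - 1)).card := by
      apply Finset.card_le_card_of_injOn Fin.val
      · intro i hi
        have hi := (Finset.mem_filter.1 (Finset.mem_coe.1 hi)).2
        exact Finset.mem_coe.2 (Finset.mem_range.2 (by omega))
      · exact Fin.val_injective.injOn
    rw [Finset.card_range] at h3
    omega) hXn
  refine ⟨F, by omega, fun w hw => (hS w).1 (hFS hw), ?_⟩
  intro x hx y hy hxy
  have hna := hFi x hx y hy hxy
  refine ⟨fun h => hna (Or.inr h), ?_⟩
  intro v hvx hvy
  obtain ⟨ex, ax, bx⟩ := hE x (hFS hx)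
  obtain ⟨ey, ay, bby⟩ := hE y (hFS hy)
  rw [ex, Sym2.mem_iff] at hvx
  rw [ey, Sym2.mem_iff] at hvy
  rcases hvx with h1 | h1 <;> rcases hvy with h2 | h2
  · exact hxy (hFa (Finset.mem_coe.2 hx) (Finset.mem_coe.2 hy) (h1.symm.trans h2))
  · rw [← h1, h2, bby] at ax
    exact absurd ax (by decide)
  · rw [← h2, h1, bx] at ay
    exact absurd ay (by decide)
  · exact hna (Or.inl (h1.symm.trans h2))

end RB

/-- **Aharoni–Berger–Kotlar–Ziv.** Matchings `M 0, …, M (2n-2)` in a bipartite graph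
with `|M i| ≥ min(i+1, n)` (0-indexed) have a partial rainbow matching of size `n`. -/
theorem degree_condition_rainbow_matching {α : Type*} (G : SimpleGraph α)
    (hbip : G.Colorable 2) (n : ℕ) (M : Fin (2 * n - 1) → Finset (Sym2 α))
    (hmatch : ∀ i, IsGraphMatching G (M i))
    (hcard : ∀ i : Fin (2 * n - 1), min (i.1 + 1) n ≤ (M i).card) :
    ∃ (ι : Fin n → Fin (2 * n - 1)) (e : Fin n → Sym2 α),
      StrictMono ι ∧ (∀ j, e j ∈ M (ι j)) ∧
        ∀ j k, j ≠ k → ∀ v : α, v ∈ e j → v ∉ e k := by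
  classical
  rcases Nat.eq_zero_or_pos n with rfl | hn
  · exact ⟨fun j => j.elim0, fun j => j.elim0, fun j => j.elim0, fun j => j.elim0,
      fun j => j.elim0⟩
  obtain ⟨F, hF, hFM, hFd⟩ := RB.rainbow_set G hbip n hn M hmatch hcard
  obtain ⟨F', hF', hc⟩ := Finset.exists_subset_card_eq hF
  have hinj : Set.InjOn Prod.fst (F' : Set (Fin (2 * n - 1) × Sym2 α)) := by
    intro x hx y hy h
    by_contra hne
    exact (hFd x (hF' hx) y (hF' hy) hne).1 h
  have hci : (F'.image Prod.fst).card = n := by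
    rw [Finset.card_image_of_injOn hinj, hc]
  have hex : ∀ j : Fin n, ∃ w ∈ F', w.1 = (F'.image Prod.fst).orderEmbOfFin hci j := by
    intro j
    exact Finset.mem_image.1 ((F'.image Prod.fst).orderEmbOfFin_mem hci j)
  choose w hw hwe using hex
  refine ⟨fun j => (w j).1, fun j => (w j).2, ?_, fun j => hFM _ (hF' (hw j)), ?_⟩
  · intro j k hjk
    simp only [hwe]
    exact (OrderEmbedding.strictMono _) hjk
  · intro j k hjk
    refine (hFd _ (hF' (hw j)) _ (hF' (hw k)) ?_).2
    intro h
    apply hjk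
    have h1 : (w j).1 = (w k).1 := by rw [h]
    rw [hwe, hwe] at h1
    exact ((F'.image Prod.fst).orderEmbOfFin hci).injective h1
end

section
/- Let ℓ ≥ 1 and m ≥ 2ℓ−1. Let X_1, …, X_m be pairwise disjoint finite sets, let P be the partition matroid on X_1 ∪ ⋯ ∪ X_m (whose independent sets are partial rainbow sets, i.e., sets with at most one element from each X_i), and let N be a matroid on a ground set containing X_1 ∪ ⋯ ∪ X_m. If there exist indices i_1 < ⋯ < i_{2ℓ−1} with ρ_N(X_{i_j}) ≥ min(j, ℓ) for each j, then η(P ∩ N) ≥ ℓ, where P ∩ N is the simplicial complex of sets independent in both P and N. -/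
noncomputable section
open scoped Classical

variable {V : Type*} [DecidableEq V] [LinearOrder V]

/-- `k`-dimensional simplicial chains (on simplices of cardinality `k`) of a set family. -/
abbrev Chains (C : Set (Finset V)) (k : ℕ) : Type _ :=
  {s : Finset V // s ∈ C ∧ s.card = k} →₀ ℚ

/-- The simplicial boundary of a single simplex of cardinality `k+1`. -/
noncomputable def bdryVec (C : Set (Finset V)) (k : ℕ)
    (σ : {s : Finset V // s ∈ C ∧ s.card = k + 1}) : Chains C k :=
  ∑ x ∈ σ.1, ((-1 : ℚ)) ^ ((σ.1.filter (fun y => y < x)).card) •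
    (if h : σ.1.erase x ∈ C ∧ (σ.1.erase x).card = k
      then Finsupp.single (⟨σ.1.erase x, h⟩ : {s : Finset V // s ∈ C ∧ s.card = k}) (1 : ℚ) else (0 : Chains C k))

/-- The simplicial boundary map. -/
noncomputable def bdry (C : Set (Finset V)) (k : ℕ) : Chains C (k + 1) →ₗ[ℚ] Chains C k :=
  Finsupp.lsum ℚ fun σ => LinearMap.toSpanSingleton ℚ _ (bdryVec C k σ)

/-- Cycles of cardinality-`k` chains (the augmented/reduced convention: every
`0`-chain, i.e. multiple of the empty simplex, is a cycle). -/
def cycles (C : Set (Finset V)) : (k : ℕ) → Submodule ℚ (Chains C k)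
  | 0 => ⊤
  | (j + 1) => LinearMap.ker (bdry C j)

/-- The reduced simplicial homology group `H̃_{k-1}(C; ℚ)` (recall simplices of
cardinality `k` have dimension `k-1`). -/
def redHomology (C : Set (Finset V)) (k : ℕ) : Type _ :=
  cycles C k ⧸ (Submodule.comap (cycles C k).subtype (LinearMap.range (bdry C k)))

instance (C : Set (Finset V)) (k : ℕ) : AddCommGroup (redHomology C k) :=
  inferInstanceAs (AddCommGroup (cycles C k ⧸ _))

/-- The topological connectivity-type invariant `η`: the least `k` such that
`H̃_{k-1}(C;ℚ) ≠ 0`, with `η = 0` for the empty complex and `η = ∞` if all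
reduced homology vanishes. -/
def eta (C : Set (Finset V)) : ℕ∞ :=
  if C = ∅ then 0
  else sInf {n : ℕ∞ | ∃ k : ℕ, n = (k : ℕ∞) ∧ Nontrivial (redHomology C k)}

/-- The independence complex of a hypergraph with edge set `E`, relative to the
ground set `W`: the sets inside `W` containing no edge. -/
def indepCplx (W : Set V) (E : Set (Finset V)) : Set (Finset V) :=
  {s : Finset V | ↑s ⊆ W ∧ ∀ f ∈ E, ¬ f ⊆ s}

end

/-- The rank `ρ_N(X)` of a set `X` in a matroid `N`. -/
noncomputable def matroidERk {α : Type*} (N : Matroid α) (X : Set α) : ℕ∞ :=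
  sSup {n : ℕ∞ | ∃ I : Set α, I ⊆ X ∧ N.Indep I ∧ I.encard = n}

namespace ML
open Finset

section chains
set_option linter.unusedSectionVars false
variable {α : Type*} [Fintype α] [LinearOrder α]

/-- elementary sign -/
def sg (x y : α) : ℚ := if y < x then -1 else 1

/-- sign of inserting `x` in front of `τ` -/
def sgn (x : α) (τ : Finset α) : ℚ := ∏ y ∈ τ, sg x y

/-- sign of a shuffle -/
def eps (τ t : Finset α) : ℚ := ∏ x ∈ t, sgn x τ

/-- boundary operator on functions -/
def bd (f : Finset α → ℚ) (τ : Finset α) : ℚ :=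
  ∑ x : α, if x ∈ τ then 0 else sgn x τ * f (insert x τ)

lemma sg_mul (x y : α) (h : x ≠ y) : sg x y * sg y x = -1 := by
  unfold sg
  rcases lt_or_gt_of_ne h with h | h <;> simp [h, not_lt_of_gt h]

lemma sg_sq (x y : α) : sg x y * sg x y = 1 := by
  unfold sg; split_ifs <;> norm_num

lemma sgn_sq (x : α) (τ : Finset α) : sgn x τ * sgn x τ = 1 := by
  unfold sgn; rw [← prod_mul_distrib]; exact prod_eq_one fun y _ => sg_sq x y

lemma eps_sq (τ t : Finset α) : eps τ t * eps τ t = 1 := by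
  unfold eps; rw [← prod_mul_distrib]; exact prod_eq_one fun y _ => sgn_sq y τ

lemma sgn_insert (x y : α) (τ : Finset α) (h : y ∉ τ) :
    sgn x (insert y τ) = sg x y * sgn x τ := by
  unfold sgn; rw [prod_insert h]

lemma sgn_anti (x y : α) (τ : Finset α) (hx : x ∉ τ) (hy : y ∉ τ) (h : x ≠ y) :
    sgn x τ * sgn y (insert x τ) = - (sgn y τ * sgn x (insert y τ)) := by
  rw [sgn_insert _ _ _ hx, sgn_insert _ _ _ hy]
  have h1 := sg_mul x y h
  have h2 := sg_sq x y
  have h3 : sg y x = - sg x y := by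
    have : sg x y * (sg x y * sg y x) = - sg x y := by rw [h1]; ring
    rw [← mul_assoc, h2, one_mul] at this; exact this
  rw [h3]; ring

lemma bd_bd (f : Finset α → ℚ) : bd (bd f) = 0 := by
  funext τ
  have key : ∀ x y : α,
      (if x ∈ τ then 0 else if y ∈ insert x τ then 0
        else sgn x τ * (sgn y (insert x τ) * f (insert y (insert x τ)))) =
      - (if y ∈ τ then 0 else if x ∈ insert y τ then 0
        else sgn y τ * (sgn x (insert y τ) * f (insert x (insert y τ)))) := by
    intro x y
    by_cases hx : x ∈ τ
    · by_cases hy : y ∈ τ <;> simp [hx, hy]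
    by_cases hy : y ∈ τ
    · simp [hx, hy]
    by_cases h : x = y
    · subst h; simp [hx]
    have h' : ¬ y = x := fun e => h e.symm
    simp only [hx, hy, h, h', mem_insert, if_false, or_self]
    rw [← mul_assoc, ← mul_assoc, sgn_anti x y τ hx hy h, Finset.insert_comm]
    ring
  have e : bd (bd f) τ = ∑ x : α, ∑ y : α, (if x ∈ τ then 0 else if y ∈ insert x τ then 0
        else sgn x τ * (sgn y (insert x τ) * f (insert y (insert x τ)))) := by
    unfold bd
    refine sum_congr rfl fun x _ => ?_
    by_cases hx : x ∈ τ
    · simp [hx]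
    · simp only [hx, if_false, mul_sum, mul_ite, mul_zero]
  have e2 : bd (bd f) τ = - bd (bd f) τ := by
    conv_lhs => rw [e, sum_comm]
    rw [e, ← sum_neg_distrib]
    refine sum_congr rfl fun x _ => ?_
    rw [← sum_neg_distrib]
    exact sum_congr rfl fun y _ => key y x
  simp only [Pi.zero_apply]; linarith

lemma bd_add (f g : Finset α → ℚ) : bd (f + g) = bd f + bd g := by
  funext τ
  simp only [bd, Pi.add_apply, ← sum_add_distrib]
  exact sum_congr rfl fun x _ => by split_ifs <;> ring

lemma bd_smul (c : ℚ) (f : Finset α → ℚ) : bd (c • f) = c • bd f := by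
  funext τ
  simp only [bd, Pi.smul_apply, smul_eq_mul, mul_sum]
  exact sum_congr rfl fun x _ => by split_ifs <;> ring

/-- supported on the sets of cardinality `k` in `C` -/
def Supp (C : Set (Finset α)) (k : ℕ) (f : Finset α → ℚ) : Prop :=
  ∀ σ, f σ ≠ 0 → σ ∈ C ∧ σ.card = k

/-- vanishing of reduced homology -/
def Acy (C : Set (Finset α)) (k : ℕ) : Prop :=
  ∀ z, Supp C k z → bd z = 0 → ∃ w, Supp C (k + 1) w ∧ bd w = z

/-- down-closed -/
def Down (C : Set (Finset α)) : Prop := ∀ σ ∈ C, ∀ τ ⊆ σ, τ ∈ C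

/-- link -/
def lk (C : Set (Finset α)) (t : Finset α) : Set (Finset α) := {τ | Disjoint τ t ∧ τ ∪ t ∈ C}

lemma Supp.bd {C : Set (Finset α)} (hC : Down C) {k : ℕ} {f : Finset α → ℚ}
    (hf : Supp C (k + 1) f) : Supp C k (bd f) := by
  intro τ hτ
  obtain ⟨x, -, hx⟩ := exists_ne_zero_of_sum_ne_zero hτ
  split_ifs at hx with h
  · exact absurd rfl hx
  · obtain ⟨h1, h2⟩ := hf _ (right_ne_zero_of_mul hx)
    rw [card_insert_of_notMem h] at h2
    exact ⟨hC _ h1 _ (subset_insert _ _), by omega⟩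

/-- link part -/
def Lt (t : Finset α) (f : Finset α → ℚ) (τ : Finset α) : ℚ :=
  if Disjoint τ t then eps τ t * f (τ ∪ t) else 0

/-- extension from link -/
def Et (t : Finset α) (c : Finset α → ℚ) (σ : Finset α) : ℚ :=
  if t ⊆ σ then eps (σ \ t) t * c (σ \ t) else 0

lemma sgn_prod (x : α) (t : Finset α) (hx : x ∉ t) :
    sgn x t * ∏ u ∈ t, sg u x = (-1) ^ t.card := by
  unfold sgn
  rw [← prod_mul_distrib, ← prod_const]
  refine prod_congr rfl fun u hu => sg_mul x u ?_
  rintro rfl; exact hx hu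

lemma bd_Lt (t : Finset α) (f : Finset α → ℚ) : bd (Lt t f) = (-1 : ℚ) ^ t.card • Lt t (bd f) := by
  funext τ
  by_cases hd : Disjoint τ t
  · simp only [Pi.smul_apply, smul_eq_mul, Lt, hd, if_true, bd, mul_sum]
    refine sum_congr rfl fun x _ => ?_
    by_cases hx : x ∈ τ
    · simp [hx]
    by_cases hxt : x ∈ t
    · simp [hx, hxt]
    have hd2 : Disjoint (insert x τ) t := by
      rw [disjoint_insert_left]; exact ⟨hxt, hd⟩
    simp only [hx, hxt, hd2, mem_union, or_self, if_true, if_false, insert_union]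
    have e1 : eps (insert x τ) t = (∏ u ∈ t, sg u x) * eps τ t := by
      unfold eps
      rw [← prod_mul_distrib]
      exact prod_congr rfl fun u _ => sgn_insert u x τ hx
    have e2 : sgn x (τ ∪ t) = sgn x τ * sgn x t := by
      unfold sgn; exact prod_union hd
    rw [e1, e2, ← sgn_prod x t hxt]
    have := sgn_sq x t
    linear_combination (-(sgn x τ * (∏ u ∈ t, sg u x) * eps τ t * f (insert x (τ ∪ t)))) * this
  · simp only [Pi.smul_apply, Lt, hd, if_false, smul_zero, bd]
    refine sum_eq_zero fun x _ => ?_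
    have : ¬ Disjoint (insert x τ) t := fun h => hd (h.mono_left (subset_insert _ _))
    simp [this]

lemma Lt_Et (t : Finset α) (c : Finset α → ℚ) (hc : ∀ τ, c τ ≠ 0 → Disjoint τ t) :
    Lt t (Et t c) = c := by
  funext τ
  unfold Lt Et
  by_cases hd : Disjoint τ t
  · have : (τ ∪ t) \ t = τ := by rw [union_sdiff_right, sdiff_eq_self_of_disjoint hd]
    simp only [hd, if_true, subset_union_right, this]
    rw [← mul_assoc, eps_sq, one_mul]
  · simp only [hd, if_false]
    by_contra h
    exact hd (hc τ (Ne.symm h))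

lemma Lt_add (t : Finset α) (f g : Finset α → ℚ) : Lt t (f + g) = Lt t f + Lt t g := by
  funext τ; simp only [Lt, Pi.add_apply]; split_ifs <;> ring

lemma Lt_smul (t : Finset α) (r : ℚ) (f : Finset α → ℚ) : Lt t (r • f) = r • Lt t f := by
  funext τ; simp only [Lt, Pi.smul_apply, smul_eq_mul]; split_ifs <;> ring

lemma Lt_zero (t : Finset α) : Lt t (0 : Finset α → ℚ) = 0 := by
  funext τ; simp [Lt]

lemma removal {C : Set (Finset α)} (hC : Down C) (t : Finset α) (k : ℕ)
    (hlk : t.card ≤ k → Acy (lk C t) (k - t.card))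
    (hdel : Acy {σ | σ ∈ C ∧ ¬ t ⊆ σ} k) : Acy C k := by
  intro z hz hbz
  by_cases htk : t.card ≤ k
  swap
  · obtain ⟨w, hw, hw2⟩ := hdel z (fun σ hσ => by
      obtain ⟨h1, h2⟩ := hz σ hσ
      exact ⟨⟨h1, fun h => htk (h2 ▸ card_le_card h)⟩, h2⟩) hbz
    exact ⟨w, fun σ hσ => ⟨(hw σ hσ).1.1, (hw σ hσ).2⟩, hw2⟩
  obtain ⟨c', hc', hbc'⟩ := hlk htk (Lt t z) (by
    intro τ hτ
    unfold Lt at hτ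
    split_ifs at hτ with hd
    · obtain ⟨h1, h2⟩ := hz _ (right_ne_zero_of_mul hτ)
      rw [card_union_of_disjoint hd] at h2
      exact ⟨⟨hd, h1⟩, by omega⟩
    · exact absurd rfl hτ) (by rw [bd_Lt, hbz, Lt_zero, smul_zero])
  set w := Et t c' with hw
  have hws : Supp C (k + 1) w := by
    intro σ hσ
    rw [hw] at hσ
    unfold Et at hσ
    split_ifs at hσ with hs
    · obtain ⟨⟨h0, h1⟩, h2⟩ := hc' _ (right_ne_zero_of_mul hσ)
      rw [sdiff_union_of_subset hs] at h1
      rw [card_sdiff_of_subset hs] at h2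
      have := card_le_card hs
      exact ⟨h1, by omega⟩
    · exact absurd rfl hσ
  have hLw : Lt t w = c' := Lt_Et t c' fun τ h => (hc' τ h).1.1
  set r : ℚ := (-1) ^ t.card with hr
  have hrr : r * r = 1 := by rw [hr, ← mul_pow]; norm_num
  have hLbw : Lt t (bd w) = r • Lt t z := by
    have := bd_Lt t w
    rw [hLw, hbc', ← hr] at this
    rw [this, smul_smul, hrr, one_smul]
  have hy : Lt t (z + (-r) • bd w) = 0 := by
    rw [Lt_add, Lt_smul, hLbw, smul_smul, neg_mul, hrr]; simp
  obtain ⟨w2, hw2, hbw2⟩ := hdel (z + (-r) • bd w) (by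
    intro σ hσ
    have hσ1 : σ ∈ C ∧ σ.card = k := by
      by_cases h : z σ = 0
      · refine hws.bd hC σ fun h' => hσ ?_
        simp [h, h']
      · exact hz σ h
    refine ⟨⟨hσ1.1, fun hs => hσ ?_⟩, hσ1.2⟩
    have h1 := congrFun hy (σ \ t)
    rw [Lt, if_pos sdiff_disjoint, sdiff_union_of_subset hs] at h1
    have h2 := eps_sq (σ \ t) t
    rcases mul_eq_zero.1 h1 with h | h
    · rw [h] at h2; norm_num at h2
    · exact h) (by rw [bd_add, bd_smul, bd_bd, hbz]; simp)
  refine ⟨w2 + r • w, ?_, ?_⟩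
  · intro σ hσ
    by_cases h : w2 σ = 0
    · refine hws σ fun h' => hσ ?_
      simp [h, h']
    · exact ⟨(hw2 σ h).1.1, (hw2 σ h).2⟩
  · rw [bd_add, bd_smul, hbw2]; simp

lemma removal_iter (T : Finset (Finset α)) (k : ℕ) : ∀ {C : Set (Finset α)}, Down C →
    (∀ σ ∈ C, ∀ t ∈ T, ∀ t' ∈ T, t ⊆ σ → t' ⊆ σ → t = t') →
    (∀ t ∈ T, t ∈ C → t.card ≤ k → Acy (lk C t) (k - t.card)) →
    Acy {σ | σ ∈ C ∧ ∀ t ∈ T, ¬ t ⊆ σ} k → Acy C k := by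
  induction T using Finset.induction_on with
  | empty => intro C _ _ _ h; simpa using h
  | insert t T ht ih =>
    intro C hC hu hl hd
    refine removal hC t k (fun htk => ?_) ?_
    · by_cases htC : t ∈ C
      · exact hl t (mem_insert_self _ _) htC htk
      · intro z hz _
        have hz0 : z = 0 := by
          funext τ
          by_contra h
          exact htC (hC _ (hz τ h).1.2 _ subset_union_right)
        exact ⟨0, fun σ h => absurd rfl h, by rw [hz0]; funext τ; simp [bd]⟩
    · refine ih (fun σ hσ τ hτ => ⟨hC σ hσ.1 τ hτ, fun h => hσ.2 (h.trans hτ)⟩)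
        (fun σ hσ a ha b hb => hu σ hσ.1 a (mem_insert_of_mem ha) b (mem_insert_of_mem hb))
        (fun s hs hsC hsk => ?_) ?_
      · have := hl s (mem_insert_of_mem hs) hsC.1 hsk
        convert this using 1
        ext τ
        constructor
        · rintro ⟨h1, h2⟩; exact ⟨h1, h2.1⟩
        · rintro ⟨h1, h2⟩
          refine ⟨h1, h2, fun h3 => ?_⟩
          have := hu _ h2 t (mem_insert_self _ _) s (mem_insert_of_mem hs) h3 subset_union_right
          exact ht (this ▸ hs)
      · convert hd using 1
        ext σ
        simp only [Set.mem_ofPred_eq, mem_insert, forall_eq_or_imp, and_assoc]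

lemma cone {C : Set (Finset α)} (a : α) (ha : ∀ σ ∈ C, insert a σ ∈ C) (k : ℕ) : Acy C k := by
  intro z hz hbz
  refine ⟨fun σ => if a ∈ σ then sgn a (σ.erase a) * z (σ.erase a) else 0, ?_, ?_⟩
  · intro σ hσ
    dsimp only at hσ
    split_ifs at hσ with h
    · obtain ⟨h1, h2⟩ := hz _ (right_ne_zero_of_mul hσ)
      have h3 := ha _ h1
      rw [insert_erase h] at h3
      rw [card_erase_of_mem h] at h2
      have := card_pos.2 ⟨a, h⟩
      exact ⟨h3, by omega⟩
    · exact absurd rfl hσ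
  · funext τ
    by_cases h : a ∈ τ
    · obtain ⟨ρ, hρ, rfl⟩ : ∃ ρ, a ∉ ρ ∧ τ = insert a ρ :=
        ⟨τ.erase a, notMem_erase _ _, (insert_erase h).symm⟩
      have h0 := congrFun hbz ρ
      have e : ∑ x : α, ((if x ∈ insert a ρ then 0 else sgn x (insert a ρ) *
          (sgn a (insert x ρ) * z (insert x ρ))) +
          sgn a ρ * (if x ∈ ρ then 0 else sgn x ρ * z (insert x ρ))) =
          ∑ x : α, if x = a then z (insert a ρ) else 0 := by
        refine sum_congr rfl fun x _ => ?_
        by_cases hx : x = a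
        · subst hx
          simp only [mem_insert, true_or, if_true, hρ, if_false, zero_add]
          rw [← mul_assoc, sgn_sq, one_mul]
        by_cases hxρ : x ∈ ρ
        · simp [hx, hxρ]
        simp only [mem_insert, hx, hxρ, or_self, if_false]
        have h1 := sgn_insert x a ρ hρ
        have h2 := sgn_insert a x ρ hxρ
        have h3 := sg_mul x a hx
        rw [h1, h2]
        linear_combination (sgn x ρ * sgn a ρ * z (insert x ρ)) * h3
      rw [sum_add_distrib, ← mul_sum] at e
      change _ + sgn a ρ * bd z ρ = _ at e
      rw [h0] at e
      simp only [Pi.zero_apply, mul_zero, add_zero, sum_ite_eq', mem_univ, if_true] at e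
      rw [← e]
      unfold bd
      refine sum_congr rfl fun x _ => ?_
      by_cases hx : x ∈ insert a ρ
      · simp [hx]
      · have hxa : a ≠ x := by rintro rfl; exact hx (mem_insert_self _ _)
        have : (insert x (insert a ρ)).erase a = insert x ρ := by
          rw [erase_insert_of_ne (Ne.symm hxa), erase_insert hρ]
        simp only [hx, if_false, this]
        simp
    · unfold bd
      rw [sum_eq_single a]
      · simp only [h, if_false, mem_insert_self, if_true, erase_insert h]
        rw [← mul_assoc, sgn_sq, one_mul]
      · intro x _ hx
        have : a ∉ insert x τ := by simp [h, Ne.symm hx]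
        simp [this]
      · simp

end chains
end ML
namespace ML
open Finset

section matroid
set_option linter.unusedSectionVars false
variable {α : Type*} [Fintype α] [LinearOrder α]

/-- rank at least `p` -/
def HasRk (N : Matroid α) (Y : Finset α) (p : ℕ) : Prop :=
  ∃ I : Finset α, I ⊆ Y ∧ N.Indep (I : Set α) ∧ p ≤ I.card

lemma HasRk.mono {N : Matroid α} {Y : Finset α} {p q : ℕ} (h : HasRk N Y q) (hpq : p ≤ q) :
    HasRk N Y p := by
  obtain ⟨I, h1, h2, h3⟩ := h
  exact ⟨I, h1, h2, hpq.trans h3⟩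

lemma augment_many {N : Matroid α} {t I : Finset α} (ht : N.Indep (t : Set α))
    (hI : N.Indep (I : Set α)) (d : ℕ) : d + t.card ≤ I.card →
    ∃ A : Finset α, A ⊆ I ∧ Disjoint A t ∧ N.Indep ((A ∪ t : Finset α) : Set α) ∧ A.card = d := by
  induction d with
  | zero => intro _; exact ⟨∅, by simp, by simp, by simpa using ht, by simp⟩
  | succ d ih =>
    intro h
    obtain ⟨A, h1, h2, h3, h4⟩ := ih (by omega)
    obtain ⟨e, he, he2, he3⟩ := h3.augment_finset hI (by
      rw [card_union_of_disjoint h2]; omega)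
    rw [mem_union, not_or] at he2
    refine ⟨insert e A, insert_subset he h1, ?_, ?_, ?_⟩
    · rw [disjoint_insert_left]; exact ⟨he2.2, h2⟩
    · rw [insert_union, coe_insert]; exact he3
    · rw [card_insert_of_notMem he2.1, h4]

lemma HasRk.contract {N : Matroid α} {Y t : Finset α} {p : ℕ} (ht : N.Indep (t : Set α))
    (h : HasRk N Y (p + t.card)) : HasRk (N.contract (t : Set α)) Y p := by
  obtain ⟨I, h1, h2, h3⟩ := h
  obtain ⟨A, a1, a2, a3, a4⟩ := augment_many ht h2 p h3
  refine ⟨A, a1.trans h1, ?_, a4.ge⟩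
  rw [ht.contract_indep_iff]
  exact ⟨by exact_mod_cast a2, by rw [← coe_union]; exact a3⟩

variable {κ : Type*} [DecidableEq κ]

/-- rainbow independent sets -/
def Cx (X : κ → Finset α) (J : Finset κ) (N : Matroid α) : Set (Finset α) :=
  {σ | (∀ x ∈ σ, ∃ i ∈ J, x ∈ X i) ∧ (∀ i, ∀ x ∈ σ, ∀ y ∈ σ, x ∈ X i → y ∈ X i → x = y) ∧
    N.Indep (σ : Set α)}

/-- rank hypothesis in counting form -/
def Hyp (X : κ → Finset α) (ℓ : ℕ) (J : Finset κ) (N : Matroid α) : Prop :=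
  ∀ p, 1 ≤ p → p ≤ ℓ → ∃ S ⊆ J, 2 * ℓ ≤ S.card + p ∧ ∀ i ∈ S, HasRk N (X i) p

lemma Cx_down (X : κ → Finset α) (J : Finset κ) (N : Matroid α) : Down (Cx X J N) := by
  rintro σ ⟨h1, h2, h3⟩ τ hτ
  exact ⟨fun x hx => h1 x (hτ hx), fun i x hx y hy => h2 i x (hτ hx) y (hτ hy),
    h3.subset (by exact_mod_cast hτ)⟩

/-- colours met by `t` -/
def met (X : κ → Finset α) (J : Finset κ) (t : Finset α) : Finset κ :=
  J.filter fun i => ∃ x ∈ t, x ∈ X i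

lemma met_card (X : κ → Finset α) (hX : ∀ i j, i ≠ j → Disjoint (X i) (X j)) (J : Finset κ)
    (t : Finset α) : (met X J t).card ≤ t.card := by
  refine card_le_card_of_forall_subsingleton (fun i x => x ∈ X i) ?_ ?_
  · intro i hi
    exact (mem_filter.1 hi).2
  · rintro x - i ⟨-, hi⟩ j ⟨-, hj⟩
    by_contra h
    exact disjoint_left.1 (hX i j h) hi hj

lemma lk_iff {X : κ → Finset α} (hX : ∀ i j, i ≠ j → Disjoint (X i) (X j)) {J : Finset κ}
    {N : Matroid α} {t : Finset α} (ht : t ∈ Cx X J N) :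
    lk (Cx X J N) t = Cx X (J \ met X J t) (N.contract (t : Set α)) := by
  obtain ⟨t1, t2, t3⟩ := ht
  ext τ
  constructor
  · rintro ⟨hd, h1, h2, h3⟩
    refine ⟨fun x hx => ?_, fun i x hx y hy => h2 i x (mem_union_left _ hx) y (mem_union_left _ hy), ?_⟩
    · obtain ⟨i, hi, hxi⟩ := h1 x (mem_union_left _ hx)
      refine ⟨i, mem_sdiff.2 ⟨hi, fun hm => ?_⟩, hxi⟩
      obtain ⟨y, hy, hyi⟩ := (mem_filter.1 hm).2
      have := h2 i x (mem_union_left _ hx) y (mem_union_right _ hy) hxi hyi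
      subst this
      exact disjoint_left.1 hd hx hy
    · rw [t3.contract_indep_iff]
      exact ⟨by exact_mod_cast hd, by rw [← coe_union]; exact h3⟩
  · rintro ⟨h1, h2, h3⟩
    rw [t3.contract_indep_iff] at h3
    have key : ∀ i, ∀ x ∈ τ, ∀ y ∈ t, x ∈ X i → y ∈ X i → False := by
      intro i x hx y hy hxi hyi
      obtain ⟨j, hj, hxj⟩ := h1 x hx
      have hij : i = j := by
        by_contra h
        exact disjoint_left.1 (hX i j h) hxi hxj
      subst hij
      rw [mem_sdiff] at hj
      exact hj.2 (mem_filter.2 ⟨hj.1, y, hy, hyi⟩)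
    refine ⟨by exact_mod_cast h3.1, ?_, ?_, by rw [coe_union]; exact h3.2⟩
    · intro x hx
      rcases mem_union.1 hx with hx | hx
      · obtain ⟨i, hi, hxi⟩ := h1 x hx
        exact ⟨i, (mem_sdiff.1 hi).1, hxi⟩
      · exact t1 x hx
    · intro i x hx y hy hxi hyi
      rcases mem_union.1 hx with hx | hx <;> rcases mem_union.1 hy with hy | hy
      · exact h2 i x hx y hy hxi hyi
      · exact (key i x hx y hy hxi hyi).elim
      · exact (key i y hy x hx hyi hxi).elim
      · exact t2 i x hx y hy hxi hyi

/-- main inductive statement -/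
theorem main_ind (X : κ → Finset α) (hX : ∀ i j, i ≠ j → Disjoint (X i) (X j)) (ℓ : ℕ) :
    ∀ (J : Finset κ) (N : Matroid α), Hyp X ℓ J N → ∀ k < ℓ, Acy (Cx X J N) k := by
  classical
  induction ℓ using Nat.strong_induction_on with
  | _ ℓ ih =>
  intro J N hH k hk
  -- the colours with nonzero rank, and one of least rank among them
  obtain ⟨i₁, hi₁J, hi₁, hmin⟩ : ∃ i₁ ∈ J, HasRk N (X i₁) 1 ∧ ∀ q, HasRk N (X i₁) q →
      ∀ i ∈ J, HasRk N (X i) 1 → HasRk N (X i) q := by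
    have hne : (J.filter fun i => HasRk N (X i) 1).Nonempty := by
      obtain ⟨S, hS, hc, hr⟩ := hH 1 le_rfl (by omega)
      have : S.Nonempty := card_pos.1 (by omega)
      obtain ⟨i, hi⟩ := this
      exact ⟨i, mem_filter.2 ⟨hS hi, hr i hi⟩⟩
    obtain ⟨i₁, h1, h2⟩ := exists_min_image _
      (fun i => Nat.findGreatest (fun q => HasRk N (X i) q) (Fintype.card α)) hne
    rw [mem_filter] at h1
    refine ⟨i₁, h1.1, h1.2, fun q hq i hi hi1 => ?_⟩
    have hqc : q ≤ Fintype.card α := by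
      obtain ⟨I, -, -, h⟩ := hq
      exact h.trans (card_le_univ I)
    have h3 : q ≤ Nat.findGreatest (fun q => HasRk N (X i₁) q) (Fintype.card α) :=
      Nat.le_findGreatest hqc hq
    have h4 := h3.trans (h2 i (mem_filter.2 ⟨hi, hi1⟩))
    have h5 : HasRk N (X i) (Nat.findGreatest (fun q => HasRk N (X i) q) (Fintype.card α)) :=
      Nat.findGreatest_spec (P := fun q => HasRk N (X i) q) (m := 1)
        (by
          obtain ⟨I, -, -, h⟩ := hi1
          exact h.trans (card_le_univ I)) hi1
    exact h5.mono h4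
  -- inductive use
  have hlink : ∀ t ∈ Cx X J N, t.Nonempty → t.card ≤ k →
      Acy (Cx X ((J \ met X J t).erase i₁) (N.contract (t : Set α))) (k - t.card) ∧
      Acy (Cx X (J \ met X J t) (N.contract (t : Set α))) (k - t.card) := by
    intro t ht htn htk
    have hs := card_pos.2 htn
    have hypE : Hyp X (ℓ - t.card) ((J \ met X J t).erase i₁) (N.contract (t : Set α)) := by
      intro p hp1 hp2
      have hcount : ∃ S ⊆ J.erase i₁, 2 * ℓ ≤ S.card + (p + t.card) ∧
          ∀ i ∈ S, HasRk N (X i) (p + t.card) := by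
        by_cases h : HasRk N (X i₁) (p + t.card)
        · obtain ⟨S, hS, hc, hr⟩ := hH 1 le_rfl (by omega)
          refine ⟨S.erase i₁, erase_subset_erase _ hS, ?_, fun i hi => ?_⟩
          · have := pred_card_le_card_erase (s := S) (a := i₁)
            omega
          · exact hmin _ h i (hS (mem_of_mem_erase hi)) (hr i (mem_of_mem_erase hi))
        · obtain ⟨S, hS, hc, hr⟩ := hH (p + t.card) (by omega) (by omega)
          refine ⟨S, fun i hi => mem_erase.2 ⟨?_, hS hi⟩, hc, hr⟩
          rintro rfl
          exact h (hr _ hi)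
      obtain ⟨S, hS, hc, hr⟩ := hcount
      refine ⟨S \ met X J t, ?_, ?_, ?_⟩
      · intro i hi
        rw [mem_sdiff] at hi
        have := mem_erase.1 (hS hi.1)
        exact mem_erase.2 ⟨this.1, mem_sdiff.2 ⟨this.2, hi.2⟩⟩
      · have h1 := le_card_sdiff (met X J t) S
        have h2 := met_card X hX J t
        omega
      · intro i hi
        exact (hr i (mem_sdiff.1 hi).1).contract ht.2.2
    have hyp2 : Hyp X (ℓ - t.card) (J \ met X J t) (N.contract (t : Set α)) := by
      intro p hp1 hp2
      obtain ⟨S, hS, h⟩ := hypE p hp1 hp2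
      exact ⟨S, hS.trans (erase_subset _ _), h⟩
    exact ⟨ih _ (by omega) _ _ hypE _ (by omega), ih _ (by omega) _ _ hyp2 _ (by omega)⟩
  -- a nonloop
  obtain ⟨a, haX, haN⟩ : ∃ a ∈ X i₁, N.Indep {a} := by
    obtain ⟨I, h1, h2, h3⟩ := hi₁
    obtain ⟨a, ha⟩ := card_pos.1 (by omega : 0 < I.card)
    exact ⟨a, h1 ha, h2.subset (by simpa using ha)⟩
  -- first round
  refine removal_iter (((X i₁).erase a).image fun x => {x}) k (Cx_down X J N) ?_ ?_ ?_
  · intro σ hσ t ht t' ht' hts hts'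
    obtain ⟨x, hx, rfl⟩ := mem_image.1 ht
    obtain ⟨y, hy, rfl⟩ := mem_image.1 ht'
    rw [singleton_subset_iff] at hts hts'
    rw [hσ.2.1 i₁ x hts y hts' (mem_of_mem_erase hx) (mem_of_mem_erase hy)]
  · intro t ht htC htk
    obtain ⟨x, hx, rfl⟩ := mem_image.1 ht
    rw [lk_iff hX htC]
    exact (hlink _ htC (singleton_nonempty x) htk).2
  -- second round
  set C₂ : Set (Finset α) := {σ | σ ∈ Cx X J N ∧ ∀ t ∈ ((X i₁).erase a).image fun x => ({x} : Finset α), ¬ t ⊆ σ} with hC₂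
  have hC₂m : ∀ σ, σ ∈ C₂ ↔ σ ∈ Cx X J N ∧ ∀ x ∈ σ, x ∈ X i₁ → x = a := by
    intro σ
    rw [hC₂, Set.mem_ofPred_eq]
    refine and_congr_right fun _ => ?_
    constructor
    · intro h x hx hxi
      by_contra hxa
      exact h {x} (mem_image_of_mem _ (mem_erase.2 ⟨hxa, hxi⟩)) (singleton_subset_iff.2 hx)
    · intro h t ht hts
      obtain ⟨x, hx, rfl⟩ := mem_image.1 ht
      rw [singleton_subset_iff] at hts
      rw [mem_erase] at hx
      exact hx.1 (h x hts hx.2)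
  have hC₂d : Down C₂ := by
    intro σ hσ τ hτ
    rw [hC₂m] at hσ ⊢
    exact ⟨Cx_down X J N σ hσ.1 τ hτ, fun x hx => hσ.2 x (hτ hx)⟩
  refine removal_iter (univ.filter fun t : Finset α => a ∉ t ∧ N.IsCircuit ((insert a t : Finset α) : Set α))
    k hC₂d ?_ ?_ ?_
  · intro σ hσ t ht t' ht' hts hts'
    rw [hC₂m] at hσ
    simp only [mem_filter, mem_univ, true_and] at ht ht'
    have key : ∀ s : Finset α, N.IsCircuit ((insert a s : Finset α) : Set α) → s ⊆ σ →
        ((insert a s : Finset α) : Set α) = N.fundCircuit a (σ : Set α) := by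
      intro s hs hsσ
      refine hs.eq_fundCircuit_of_subset hσ.1.2.2 ?_
      rw [← coe_insert]
      exact_mod_cast insert_subset_insert a hsσ
    have e := (key t ht.2 hts).trans (key t' ht'.2 hts').symm
    have e2 : insert a t = insert a t' := by exact_mod_cast e
    rw [← erase_insert ht.1, e2, erase_insert ht'.1]
  · intro t ht htC htk
    simp only [mem_filter, mem_univ, true_and] at ht
    rw [hC₂m] at htC
    have htn : t.Nonempty := by
      rw [nonempty_iff_ne_empty]
      rintro rfl
      exact ht.2.not_indep (by simpa using haN)
    convert (hlink t htC.1 htn htk).1 using 1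
    ext τ
    have hl := lk_iff hX htC.1
    constructor
    · rintro ⟨hd, h⟩
      rw [hC₂m] at h
      have h1 : τ ∈ lk (Cx X J N) t := ⟨hd, h.1⟩
      rw [hl] at h1
      refine ⟨fun x hx => ?_, h1.2⟩
      obtain ⟨i, hi, hxi⟩ := h1.1 x hx
      refine ⟨i, mem_erase.2 ⟨?_, hi⟩, hxi⟩
      rintro rfl
      have hxa := h.2 x (mem_union_left _ hx) hxi
      subst hxa
      refine ht.2.not_indep (h.1.2.2.subset ?_)
      exact_mod_cast insert_subset (mem_union_left _ hx) subset_union_right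
    · intro h
      have h1 : τ ∈ lk (Cx X J N) t := by
        rw [hl]
        refine ⟨fun x hx => ?_, h.2⟩
        obtain ⟨i, hi, hxi⟩ := h.1 x hx
        exact ⟨i, mem_of_mem_erase hi, hxi⟩
      refine ⟨h1.1, ?_⟩
      rw [hC₂m]
      refine ⟨h1.2, fun x hx hxi => ?_⟩
      rcases mem_union.1 hx with hx | hx
      · obtain ⟨i, hi, hxi'⟩ := h.1 x hx
        exact (disjoint_left.1 (hX i i₁ (ne_of_mem_erase hi)) hxi' hxi).elim
      · exact htC.2 x hx hxi
  -- cone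
  refine cone a ?_ k
  rintro σ ⟨hσ, hσt⟩
  have hσ' := (hC₂m σ).1 hσ
  simp only [mem_filter, mem_univ, true_and, and_imp] at hσt
  by_cases haσ : a ∈ σ
  · rw [insert_eq_of_mem haσ]; exact ⟨hσ, by simpa using hσt⟩
  refine ⟨(hC₂m _).2 ⟨⟨?_, ?_, ?_⟩, ?_⟩, ?_⟩
  · intro x hx
    rcases mem_insert.1 hx with rfl | hx
    · exact ⟨i₁, hi₁J, haX⟩
    · exact hσ'.1.1 x hx
  · have key : ∀ i, ∀ y ∈ σ, a ∈ X i → y ∈ X i → a = y := by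
      intro i y hy hai hyi
      have : i = i₁ := by
        by_contra h
        exact disjoint_left.1 (hX i i₁ h) hai haX
      subst this
      exact (hσ'.2 y hy hyi).symm
    intro i x hx y hy hxi hyi
    rcases mem_insert.1 hx with hxa | hx1
    · rcases mem_insert.1 hy with hya | hy1
      · rw [hxa, hya]
      · rw [hxa] at hxi ⊢; exact key i y hy1 hxi hyi
    · rcases mem_insert.1 hy with hya | hy1
      · rw [hya] at hyi ⊢; exact (key i x hx1 hyi hxi).symm
      · exact hσ'.1.2.1 i x hx1 y hy1 hxi hyi
  · by_contra hdep
    have hE : ((insert a σ : Finset α) : Set α) ⊆ N.E := by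
      rw [coe_insert]
      exact Set.insert_subset (haN.subset_ground rfl) hσ'.1.2.2.subset_ground
    rw [Matroid.not_indep_iff hE] at hdep
    obtain ⟨K, hK, hKc⟩ := hdep.exists_isCircuit_subset
    have haK : a ∈ K := by
      by_contra haK
      refine hKc.not_indep (hσ'.1.2.2.subset fun x hx => ?_)
      have := hK hx
      rw [coe_insert] at this
      rcases this with rfl | h
      · exact (haK hx).elim
      · exact h
    refine hσt (K.toFinset.erase a) (notMem_erase _ _) ?_ ?_
    · rw [insert_erase (by simpa using haK)]; simpa using hKc
    · intro x hx
      rw [mem_erase, Set.mem_toFinset] at hx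
      have := hK hx.2
      rw [coe_insert] at this
      rcases this with h | h
      · exact (hx.1 h).elim
      · exact h
  · intro x hx hxi
    rcases mem_insert.1 hx with rfl | hx
    · rfl
    · exact hσ'.2 x hx hxi
  · intro t ht hts
    simp only [mem_filter, mem_univ, true_and] at ht
    refine hσt t ht.1 ht.2 fun x hx => ?_
    rcases mem_insert.1 (hts hx) with rfl | h
    · exact (ht.1 hx).elim
    · exact h

end matroid
end ML
namespace ML
open Finset

section bridge
set_option linter.unusedSectionVars false
variable {α : Type*} [Fintype α] [LinearOrder α]

open scoped Classical in
/-- chains as functions -/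
noncomputable def toF (C : Set (Finset α)) (k : ℕ) : Chains C k →ₗ[ℚ] (Finset α → ℚ) where
  toFun z σ := if h : σ ∈ C ∧ σ.card = k then z ⟨σ, h⟩ else 0
  map_add' a b := by funext σ; simp only [Pi.add_apply]; split_ifs <;> simp
  map_smul' r a := by
    funext σ; simp only [Pi.smul_apply, RingHom.id_apply]; split_ifs <;> simp

lemma toF_apply (C : Set (Finset α)) (k : ℕ) (z : Chains C k)
    (σ : {s : Finset α // s ∈ C ∧ s.card = k}) : toF C k z σ.1 = z σ := by
  simp [toF, σ.2]

lemma toF_inj (C : Set (Finset α)) (k : ℕ) : Function.Injective (toF C k) := by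
  intro a b h
  ext σ
  rw [← toF_apply, ← toF_apply, h]

lemma toF_supp (C : Set (Finset α)) (k : ℕ) (z : Chains C k) : Supp C k (toF C k z) := by
  intro σ hσ
  by_contra h
  exact hσ (by simp [toF, h])

lemma toF_surj (C : Set (Finset α)) (k : ℕ) (f : Finset α → ℚ) (hf : Supp C k f) :
    ∃ z, toF C k z = f := by
  classical
  refine ⟨Finsupp.equivFunOnFinite.symm fun σ => f σ.1, ?_⟩
  funext σ
  by_cases h : σ ∈ C ∧ σ.card = k
  · simp [toF, h]
  · have : f σ = 0 := by by_contra h'; exact h (hf σ h')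
    simp [toF, h, this]

lemma toF_single (C : Set (Finset α)) (k : ℕ) (σ : {s : Finset α // s ∈ C ∧ s.card = k})
    (τ : Finset α) : toF C k (Finsupp.single σ 1) τ = if σ.1 = τ then 1 else 0 := by
  classical
  by_cases h : τ ∈ C ∧ τ.card = k
  · have := toF_apply C k (Finsupp.single σ 1) ⟨τ, h⟩
    rw [this, Finsupp.single_apply]
    simp [Subtype.ext_iff]
  · have : σ.1 ≠ τ := by rintro rfl; exact h σ.2
    simp [toF, h, this]

lemma sgn_eq (x : α) (τ : Finset α) (hx : x ∉ τ) :
    sgn x τ = (-1 : ℚ) ^ ((insert x τ).filter (fun y => y < x)).card := by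
  unfold sgn sg
  rw [prod_ite, prod_const, prod_const_one, mul_one, filter_insert, if_neg (lt_irrefl x)]

lemma toF_bdry (C : Set (Finset α)) (hC : Down C) (k : ℕ) (z : Chains C (k + 1)) :
    toF C k (bdry C k z) = bd (toF C (k + 1) z) := by
  classical
  induction z using Finsupp.induction_linear with
  | zero => simp only [map_zero]; funext τ; simp [bd]
  | add f g hf hg => simp only [map_add, hf, hg, bd_add]
  | single σ r =>
    have e : (Finsupp.single σ r : Chains C (k + 1)) = r • Finsupp.single σ 1 := by simp
    rw [e]
    simp only [map_smul, bd_smul]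
    congr 1
    have e2 : bdry C k (Finsupp.single σ 1) = bdryVec C k σ := by
      simp [bdry, LinearMap.toSpanSingleton_apply]
    rw [e2]
    funext τ
    unfold bdryVec bd
    rw [map_sum, Finset.sum_apply, ← Finset.sum_filter_add_sum_filter_not univ (fun x => x ∈ σ.1)]
    rw [Finset.filter_mem_eq_inter, univ_inter]
    rw [Finset.sum_eq_zero (s := filter (fun x => x ∉ σ.1) univ), add_zero]
    · refine sum_congr rfl fun x hx => ?_
      have hm : σ.1.erase x ∈ C ∧ (σ.1.erase x).card = k :=
        ⟨hC _ σ.2.1 _ (erase_subset _ _), by rw [card_erase_of_mem hx, σ.2.2]; rfl⟩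
      rw [dif_pos hm, map_smul, Pi.smul_apply, toF_single, toF_single]
      by_cases he : σ.1.erase x = τ
      · have hxt : x ∉ τ := by rw [← he]; exact notMem_erase _ _
        have hin : insert x τ = σ.1 := by rw [← he, insert_erase hx]
        rw [if_pos he, if_neg hxt, if_pos hin.symm, sgn_eq x τ hxt, hin]
        simp
      · rw [if_neg he]
        split_ifs with h1 h2
        · simp
        · exact (he (by rw [h2, erase_insert h1])).elim
        · simp
    · intro x hx
      rw [mem_filter] at hx
      rw [toF_single]
      have : σ.1 ≠ insert x τ := fun h => hx.2 (h ▸ mem_insert_self _ _)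
      simp [this]

lemma bd_card_zero (C : Set (Finset α)) (f : Finset α → ℚ) (hf : Supp C 0 f) : bd f = 0 := by
  funext τ
  refine sum_eq_zero fun x _ => ?_
  split_ifs with h
  · rfl
  · have : f (insert x τ) = 0 := by
      by_contra h'
      have := (hf _ h').2
      simp at this
    simp [this]

lemma not_nontrivial (C : Set (Finset α)) (hC : Down C) (k : ℕ) (h : Acy C k) :
    ¬ Nontrivial (redHomology C k) := by
  rw [not_nontrivial_iff_subsingleton]
  unfold redHomology
  rw [Submodule.Quotient.subsingleton_iff, eq_top_iff]
  rintro ⟨z, hz⟩ -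
  rw [Submodule.mem_comap, Submodule.subtype_apply]
  have hbz : bd (toF C k z) = 0 := by
    cases k with
    | zero => exact bd_card_zero C _ (toF_supp C 0 z)
    | succ j =>
      have hz' : bdry C j z = 0 := hz
      rw [← toF_bdry C hC, hz', map_zero]
  obtain ⟨w, hw, hwz⟩ := h _ (toF_supp C k z) hbz
  obtain ⟨w', rfl⟩ := toF_surj C (k + 1) w hw
  refine ⟨w', toF_inj C k ?_⟩
  rw [toF_bdry C hC, hwz]

end bridge
end ML

/-- **Main lemma.** Let `ℓ ≥ 1`, `m ≥ 2ℓ-1`, let `P` be the partition matroid on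
pairwise disjoint sets `X 0, …, X (m-1)`, and `N` a matroid on a ground set containing
their union. If there are indices `i 0 < ⋯ < i (2ℓ-2)` with `ρ_N(X (i j)) ≥ min(j+1, ℓ)`
(0-indexed `j`), then `η(P ∩ N) ≥ ℓ`, where `P ∩ N` is the complex of sets independent
in both: subsets of `⋃ X i` meeting each `X i` at most once and independent in `N`. -/
theorem main_lemma {α : Type*} [Fintype α] [LinearOrder α]
    (ℓ m : ℕ) (hℓ : 1 ≤ ℓ) (hm : 2 * ℓ - 1 ≤ m)
    (X : Fin m → Finset α)
    (hdisj : ∀ i j, i ≠ j → Disjoint (X i) (X j))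
    (N : Matroid α) (hground : ∀ i, ↑(X i) ⊆ N.E)
    (ι : Fin (2 * ℓ - 1) → Fin m) (hι : StrictMono ι)
    (hrank : ∀ j : Fin (2 * ℓ - 1),
      (min (j.1 + 1) ℓ : ℕ∞) ≤ matroidERk N (↑(X (ι j)) : Set α)) :
    (ℓ : ℕ∞) ≤ eta {s : Finset α |
      (↑s : Set α) ⊆ ⋃ i, (↑(X i) : Set α) ∧
      (∀ i, (s ∩ X i).card ≤ 1) ∧ N.Indep (↑s : Set α)} := by
  
  classical
  have hset : {s : Finset α | (↑s : Set α) ⊆ ⋃ i, (↑(X i) : Set α) ∧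
      (∀ i, (s ∩ X i).card ≤ 1) ∧ N.Indep (↑s : Set α)} = ML.Cx X Finset.univ N := by
    ext s
    refine and_congr ?_ (and_congr_left fun _ => forall_congr' fun i => ?_)
    · simp [Set.subset_def]
    · rw [Finset.card_le_one]
      constructor
      · intro h x hx y hy hxi hyi
        exact h x (Finset.mem_inter.2 ⟨hx, hxi⟩) y (Finset.mem_inter.2 ⟨hy, hyi⟩)
      · intro h x hx y hy
        rw [Finset.mem_inter] at hx hy
        exact h x hx.1 y hy.1 hx.2 hy.2
  rw [hset]
  have hHyp : ML.Hyp X ℓ Finset.univ N := by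
    intro p hp1 hp2
    have hp : p - 1 ≤ 2 * ℓ - 1 := by omega
    refine ⟨(Finset.univ.filter fun j : Fin (2 * ℓ - 1) => p ≤ j.1 + 1).image ι,
      Finset.subset_univ _, ?_, ?_⟩
    · rw [Finset.card_image_of_injective _ hι.injective]
      have h1 : (Finset.univ.filter fun j : Fin (2 * ℓ - 1) => ¬ p ≤ j.1 + 1).card ≤ p - 1 := by
        rw [← Finset.card_range (p - 1)]
        refine Finset.card_le_card_of_injOn (fun j => j.1) ?_ (fun a _ b _ h => Fin.ext h)
        intro j hj
        simp only [Finset.coe_filter, Finset.mem_univ, true_and, Set.mem_ofPred_eq] at hj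
        simp only [Finset.coe_range, Set.mem_Iio]
        omega
      have h2 := Finset.card_filter_add_card_filter_not (s := Finset.univ)
        (fun j : Fin (2 * ℓ - 1) => p ≤ j.1 + 1)
      rw [Finset.card_univ, Fintype.card_fin] at h2
      omega
    · intro i hi
      obtain ⟨j, hj, rfl⟩ := Finset.mem_image.1 hi
      have hj' : p ≤ j.1 + 1 := (Finset.mem_filter.1 hj).2
      by_contra hno
      have hle : matroidERk N (↑(X (ι j)) : Set α) ≤ ((p - 1 : ℕ) : ℕ∞) := by
        refine sSup_le ?_
        rintro n ⟨I, hI, hIN, rfl⟩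
        rw [Set.encard_eq_coe_toFinset_card, Nat.cast_le]
        by_contra hc
        refine hno ⟨I.toFinset, ?_, by simpa using hIN, by omega⟩
        intro x hx
        exact hI (by simpa using hx)
      have h3 := (hrank j).trans hle
      have h4 : ((min (j.1 + 1) ℓ : ℕ) : ℕ∞) ≤ ((p - 1 : ℕ) : ℕ∞) := by
        push_cast at h3 ⊢
        exact h3
      rw [Nat.cast_le] at h4
      omega
  have hne : ML.Cx X Finset.univ N ≠ ∅ := by
    refine Set.Nonempty.ne_empty ⟨∅, ?_, ?_, ?_⟩ <;> simp
  unfold eta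
  rw [if_neg hne]
  refine le_sInf ?_
  rintro n ⟨k, rfl, hk⟩
  rw [Nat.cast_le]
  by_contra hlt
  exact ML.not_nontrivial _ (ML.Cx_down X _ N) k
    (ML.main_ind X hdisj ℓ _ N hHyp k (by omega)) hk
end
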